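/- Every primitive ideal of U with nonzero central charge is the annihilator of a simple highest weight module with nonzero central charge; that is, if I = Ann_U(S) for a simple U-module S on which z acts by a nonzero scalar ż, then I = Ann_U(L(λ)) for some λ ∈ h* with λ(z) = ż. -/

import Mathlib

namespace Schrodinger

noncomputable section

open scoped TensorProduct

/-- Generators of the Schrödinger algebra. -/
inductive Gen : Type
  | E | H | F | P | Q | Z
  deriving DecidableEq

/-- The free algebra on the generators. -/
abbrev FA : Type := FreeAlgebra ℂ Gen

/-- Inclusion of generators. -/
def ιg (g : Gen) : FA := FreeAlgebra.ι ℂ g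

/-- The defining relations of the universal enveloping algebra of the Schrödinger
algebra `s`: `z` is central and `[h,e]=2e`, `[e,f]=h`, `[h,f]=-2f`, `[e,q]=p`,
`[e,p]=0`, `[h,p]=p`, `[f,p]=q`, `[f,q]=0`, `[h,q]=-q`, `[p,q]=z`. -/
inductive Rel : FA → FA → Prop
  | he : Rel (ιg .H * ιg .E) (ιg .E * ιg .H + 2 * ιg .E)
  | ef : Rel (ιg .E * ιg .F) (ιg .F * ιg .E + ιg .H)
  | hf : Rel (ιg .H * ιg .F) (ιg .F * ιg .H - 2 * ιg .F)
  | eq : Rel (ιg .E * ιg .Q) (ιg .Q * ιg .E + ιg .P)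
  | ep : Rel (ιg .E * ιg .P) (ιg .P * ιg .E)
  | hp : Rel (ιg .H * ιg .P) (ιg .P * ιg .H + ιg .P)
  | fp : Rel (ιg .F * ιg .P) (ιg .P * ιg .F + ιg .Q)
  | fq : Rel (ιg .F * ιg .Q) (ιg .Q * ιg .F)
  | hq : Rel (ιg .H * ιg .Q) (ιg .Q * ιg .H - ιg .Q)
  | pq : Rel (ιg .P * ιg .Q) (ιg .Q * ιg .P + ιg .Z)
  | ze : Rel (ιg .Z * ιg .E) (ιg .E * ιg .Z)
  | zh : Rel (ιg .Z * ιg .H) (ιg .H * ιg .Z)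
  | zf : Rel (ιg .Z * ιg .F) (ιg .F * ιg .Z)
  | zp : Rel (ιg .Z * ιg .P) (ιg .P * ιg .Z)
  | zq : Rel (ιg .Z * ιg .Q) (ιg .Q * ιg .Z)

/-- The universal enveloping algebra `U = U(s)` of the Schrödinger algebra,
presented by generators and relations (via the PBW theorem). -/
abbrev U : Type := RingQuot Rel

/-- The generators of `U`. -/
def gen (g : Gen) : U := RingQuot.mkAlgHom ℂ Rel (ιg g)

def E : U := gen .E
def H : U := gen .H
def F : U := gen .F
def P : U := gen .P
def Q : U := gen .Q
def Z : U := gen .Z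

/-- Scalars inside `U`. -/
def sc (a : ℂ) : U := algebraMap ℂ U a

/-- The Casimir element `c = (h² + h + 4fe)z − 2(fp² − eq² − hpq)`. -/
def cElt : U := (H * H + H + 4 * (F * E)) * Z - 2 * (F * (P * P) - E * (Q * Q) - H * (P * Q))

/-- The left ideal of `U` defining the Verma module `Δ(λ)` for
`λ ∈ 𝔥*` with `λ(h) = hh`, `λ(z) = zz`:  it is generated by `n₊ = span{e,p}`
together with `h - λ(h)` and `z - λ(z)`; then
`Δ(λ) = U ⊗_{U(𝔟)} ℂ_λ ≅ U / U(e, p, h - λ(h), z - λ(z))`. -/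
def vermaIdeal (hh zz : ℂ) : Submodule U U :=
  Submodule.span U ({E, P, H - sc hh, Z - sc zz} : Set U)

/-- The Verma module `Δ(λ)` with highest weight `λ`, `λ(h) = hh`, `λ(z) = zz`. -/
abbrev Verma (hh zz : ℂ) : Type := U ⧸ vermaIdeal hh zz

/-- The canonical highest weight generator `v_λ` of `Δ(λ)`. -/
def hwVec (hh zz : ℂ) : Verma hh zz := Submodule.Quotient.mk 1

/-- The unique maximal submodule `K(λ)` of `Δ(λ)`. -/
def vermaRad (hh zz : ℂ) : Submodule U (Verma hh zz) := sSup {N : Submodule U (Verma hh zz) | N ≠ ⊤}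

/-- The simple highest weight module `L(λ) = Δ(λ)/K(λ)`. -/
abbrev SimpleHW (hh zz : ℂ) : Type := Verma hh zz ⧸ vermaRad hh zz

/-- The scalar `ϑ_λ = (λ(h)² + 3λ(h) + 2)·λ(z)` by which the Casimir element `c`
acts on the Verma module `Δ(λ)`. -/
def vartheta (hh zz : ℂ) : ℂ := (hh ^ 2 + 3 * hh + 2) * zz

end

end Schrodinger

namespace Schrodinger

noncomputable section

open CategoryTheory

/-- The `ℂ`-vector space structure on a `U`-module, obtained by restricting
scalars along `ℂ → U`. -/
def cmod (M : Type) [AddCommGroup M] [Module U M] : Module ℂ M :=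
  Module.compHom M (algebraMap ℂ U)

/-- `v` is a weight vector of weight `λ` with `λ(h) = hh` and `λ(z) = zz`. -/
def IsWeightVec {M : Type} [AddCommGroup M] [Module U M] (hh zz : ℂ) (v : M) : Prop :=
  H • v = sc hh • v ∧ Z • v = sc zz • v

/-- The subalgebra `U(n₊)` of `U` generated by `n₊ = span{e, p}`. -/
def nPlus : Subalgebra ℂ U := Algebra.adjoin ℂ ({E, P} : Set U)

/-- Membership in category `O`: finitely generated, a (direct) sum of its
weight spaces, and locally `U(n₊)`-finite. -/
def InO (M : Type) [AddCommGroup M] [Module U M] : Prop :=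
  Module.Finite U M ∧
  (∀ v : M, v ∈ AddSubgroup.closure {w : M | ∃ hh zz : ℂ, IsWeightVec hh zz w}) ∧
  (letI := cmod M
   ∀ v : M, ∃ W : Submodule ℂ M, FiniteDimensional ℂ W ∧ ∀ u ∈ nPlus, u • v ∈ W)

/-- Membership in the block `O[ξ]`, where `ξ ∈ 𝔥*/ℤR` is the class of the weight
`(hh0, zz0)` (so that the weights in `ξ` are exactly `(hh0 + n, zz0)`, `n ∈ ℤ`):
the module is in `O` and all its weights lie in `ξ`. -/
def InBlock (hh0 zz0 : ℂ) (M : ModuleCat.{0} U) : Prop :=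
  InO M ∧
  ∀ (v : M) (hh zz : ℂ), v ≠ 0 → IsWeightVec hh zz v → zz = zz0 ∧ ∃ n : ℤ, hh = hh0 + n

/-- The Verma module as an object of the category of `U`-modules. -/
def VermaC (hh zz : ℂ) : ModuleCat.{0} U := ModuleCat.of U (Verma hh zz)

/-- `Pc` is a Serre class inside the subcategory (of the category of `U`-modules)
cut out by `Oc`: it is contained in `Oc`, closed under isomorphism, and for every
short exact sequence `0 → N → M → M/N → 0` in `Oc`, `M` belongs to `Pc` if and only
if both `N` and `M/N` do. -/
def SerreClassIn (Oc Pc : ModuleCat.{0} U → Prop) : Prop :=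
  (∀ M, Pc M → Oc M) ∧
  (∀ M N : ModuleCat.{0} U, Nonempty ((M : Type) ≃ₗ[U] (N : Type)) → Pc M → Oc N → Pc N) ∧
  (∀ (M : ModuleCat.{0} U) (N : Submodule U M), Oc M →
      (Pc M ↔ Pc (ModuleCat.of U N) ∧ Pc (ModuleCat.of U ((M : Type) ⧸ N))))

/-- Membership in the Serre subcategory of the subcategory cut out by `Oc`
generated by the set of objects `S`. -/
def InSerreGen (Oc : ModuleCat.{0} U → Prop) (S : Set (ModuleCat.{0} U))
    (M : ModuleCat.{0} U) : Prop :=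
  Oc M ∧ ∀ Pc : ModuleCat.{0} U → Prop, SerreClassIn Oc Pc → (∀ X ∈ S, Pc X) → Pc M

end

end Schrodinger

namespace Schrodinger

section Auxiliary

open Polynomial

section Ring

variable {R : Type*} [Ring R] [Algebra ℂ R]

theorem mul_pow_shift {h e : R} {c : ℂ} (H : h * e = e * (h + algebraMap ℂ R c)) (k : ℕ) :
    h * e ^ k = e ^ k * (h + algebraMap ℂ R (k * c)) := by
  induction k with
  | zero => simp
  | succ k ih =>
    rw [pow_succ, ← mul_assoc, ih, mul_assoc, add_mul, H,
      Algebra.commutes (k * c : ℂ) e, ← mul_add, add_assoc, ← map_add, mul_assoc]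
    congr 4
    push_cast; ring

theorem aeval_mul_shift {h x : R} {c : ℂ} (H : h * x = x * (h + algebraMap ℂ R c)) (g : ℂ[X]) :
    aeval h g * x = x * aeval h (g.comp (X + C c)) := by
  have H' : h * x = x * aeval h (X + C c) := by simpa using H
  induction g using Polynomial.induction_on' with
  | add a b ha hb => simp [add_mul, mul_add, ha, hb]
  | monomial n a =>
    rw [← C_mul_X_pow_eq_monomial, mul_comp, C_comp, X_pow_comp, map_mul, map_mul, aeval_C,
      map_pow, map_pow, aeval_X, mul_assoc, ← mul_assoc x, ← Algebra.commutes, mul_assoc]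
    congr 1
    induction n with
    | zero => simp
    | succ n ih => rw [pow_succ, mul_assoc, H', ← mul_assoc, ih, mul_assoc, ← pow_succ]

/-- A submodule of `R` closed under multiplication on both sides. -/
def IsTwoSidedSub (I : Submodule ℂ R) : Prop :=
  ∀ x y, y ∈ I → x * y ∈ I ∧ y * x ∈ I

theorem mem_of_sum_pow_mul_mem {I : Submodule ℂ R} (hI : IsTwoSidedSub I) {q d : R} {c : ℂ}
    (hc : c ≠ 0) (hd : d * q = q * d + algebraMap ℂ R c) (n : ℕ) (y : ℕ → R)
    (hy : ∀ i, Commute d (y i)) (hsum : ∑ i ∈ Finset.range n, q ^ i * y i ∈ I) :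
    ∀ i < n, y i ∈ I := by
  have hpow : ∀ i : ℕ, d * q ^ (i + 1) = q ^ (i + 1) * d + ((i + 1 : ℂ) * c) • q ^ i := by
    intro i
    induction i with
    | zero => simp [hd, Algebra.smul_def]
    | succ i ih =>
      rw [pow_succ, ← mul_assoc, ih, add_mul, mul_assoc, hd, mul_add, ← mul_assoc, smul_mul_assoc,
        ← pow_succ, ← pow_succ, ← Algebra.commutes, ← Algebra.smul_def, add_assoc, ← add_smul]
      congr 2
      push_cast; ring
  induction n generalizing y with
  | zero => simp
  | succ n ih =>
    have key : ∑ i ∈ Finset.range n, q ^ i * (((i + 1 : ℂ) * c) • y (i + 1)) ∈ I := by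
      have h1 := I.sub_mem (hI d _ hsum).1 (hI d _ hsum).2
      convert h1 using 1
      rw [Finset.mul_sum, Finset.sum_mul, ← Finset.sum_sub_distrib, Finset.sum_range_succ']
      have h0 : d * (q ^ 0 * y 0) - q ^ 0 * y 0 * d = 0 := by simp [(hy 0).eq]
      rw [h0, add_zero]
      refine Finset.sum_congr rfl fun i _ => ?_
      rw [← mul_assoc d, hpow, mul_assoc _ (y (i + 1)) d, ← (hy (i + 1)).eq, ← mul_assoc,
        ← sub_mul, add_sub_cancel_left, smul_mul_assoc, mul_smul_comm]
    have h2 : ∀ i < n, y (i + 1) ∈ I := by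
      intro i hi
      have h3 := ih (fun i => ((i + 1 : ℂ) * c) • y (i + 1))
        (fun i => (hy (i + 1)).smul_right _) key i hi
      have h4 : ((i + 1 : ℂ) * c) ≠ 0 := mul_ne_zero (by exact_mod_cast i.succ_ne_zero) hc
      exact (I.smul_mem_iff h4).1 h3
    intro i hi
    rcases i with _ | i
    · rw [Finset.sum_range_succ'] at hsum
      have := (I.add_mem_iff_right (I.sum_mem fun i hi =>
        (hI (q ^ (i + 1)) _ (h2 i (Finset.mem_range.1 hi))).1)).1 hsum
      simpa using this
    · exact h2 i (by omega)

theorem mem_of_sum_weight_mem {I : Submodule ℂ R} (hI : IsTwoSidedSub I) {h : R} {ι : Type*}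
    (a : ι → ℂ) (ha : Function.Injective a) (s : Finset ι) (x : ι → R)
    (hx : ∀ i, h * x i - x i * h = a i • x i) (hsum : ∑ i ∈ s, x i ∈ I) :
    ∀ i ∈ s, x i ∈ I := by
  classical
  induction s using Finset.induction_on generalizing x with
  | empty => simp
  | insert j s hj ih =>
    have key : ∑ i ∈ s, (a i - a j) • x i ∈ I := by
      have h1 := I.sub_mem (I.sub_mem (hI h _ hsum).1 (hI h _ hsum).2) (I.smul_mem (a j) hsum)
      convert h1 using 1
      rw [Finset.mul_sum, Finset.sum_mul, ← Finset.sum_sub_distrib, Finset.smul_sum,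
        ← Finset.sum_sub_distrib, Finset.sum_insert hj, hx, sub_self, zero_add]
      refine Finset.sum_congr rfl fun i _ => ?_
      rw [hx, sub_smul]
    have h2 : ∀ i ∈ s, x i ∈ I := by
      intro i hi
      have h3 := ih (fun i => (a i - a j) • x i) (fun i => by
        rw [mul_smul_comm, smul_mul_assoc, ← smul_sub, hx, smul_comm]) key i hi
      have h4 : a i - a j ≠ 0 := sub_ne_zero.2 fun h => hj (ha h ▸ hi)
      exact (I.smul_mem_iff h4).1 h3
    intro i hi
    rcases Finset.mem_insert.1 hi with rfl | hi
    · rw [Finset.sum_insert hj] at hsum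
      exact (I.add_mem_iff_left (I.sum_mem h2)).1 hsum
    · exact h2 i hi

/-- Generators of `U(sl₂)/(C - χ) ⊗ A₁`, where `C = 4fe + h² + 2h` and `[p,q] = zz`. -/
structure WeylSl2 (zz χ : ℂ) (e h f p q : R) : Prop where
  pq : p * q = q * p + algebraMap ℂ R zz
  pe : Commute p e
  ph : Commute p h
  pf : Commute p f
  qe : Commute q e
  qh : Commute q h
  qf : Commute q f
  he : h * e = e * (h + algebraMap ℂ R 2)
  hf : h * f = f * (h + algebraMap ℂ R (-2))
  fe : f * e = aeval h (C (4⁻¹ : ℂ) * (C χ - X ^ 2 - 2 * X))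
  ef : e * f = aeval h (C (4⁻¹ : ℂ) * (C χ - X ^ 2 + 2 * X))

/-- The monomials `eᵏ`, `fᵏ` of `ad h`-weight `2k`, indexed by `k : ℤ`. -/
def wmon (e f : R) : ℤ → R
  | .ofNat k => e ^ k
  | .negSucc k => f ^ (k + 1)

namespace WeylSl2

variable {zz χ : ℂ} {e h f p q : R}

theorem h_wmon (A : WeylSl2 zz χ e h f p q) (k : ℤ) :
    h * wmon e f k = wmon e f k * (h + algebraMap ℂ R (2 * k)) := by
  cases k with
  | ofNat k => rw [wmon, mul_pow_shift A.he, mul_comm]; simp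
  | negSucc k =>
    rw [wmon, mul_pow_shift A.hf]
    congr 3
    push_cast; ring

/-- The span of the `eᵏ g(h)` and `fᵏ g(h)`. -/
def slSpan (e h f : R) : Submodule ℂ R :=
  Submodule.span ℂ (Set.range fun x : ℤ × ℂ[X] => wmon e f x.1 * aeval h x.2)

theorem wmon_mem (k : ℤ) (g : ℂ[X]) : wmon e f k * aeval h g ∈ slSpan e h f :=
  Submodule.subset_span ⟨(k, g), rfl⟩

theorem aeval_wmon_mem (A : WeylSl2 zz χ e h f p q) (k : ℤ) (g g' : ℂ[X]) :
    aeval h g * wmon e f k * aeval h g' ∈ slSpan e h f := by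
  rw [aeval_mul_shift (A.h_wmon k), mul_assoc, ← map_mul]
  exact wmon_mem _ _

theorem mul_mem_slSpan (A : WeylSl2 zz χ e h f p q) {x : R} (hx : x ∈ slSpan e h f) :
    e * x ∈ slSpan e h f ∧ h * x ∈ slSpan e h f ∧ f * x ∈ slSpan e h f := by
  induction hx using Submodule.span_induction with
  | zero => simp
  | add a b _ _ ha hb =>
    simp only [mul_add]
    exact ⟨add_mem ha.1 hb.1, add_mem ha.2.1 hb.2.1, add_mem ha.2.2 hb.2.2⟩
  | smul c a _ ha =>
    simp only [mul_smul_comm]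
    exact ⟨Submodule.smul_mem _ _ ha.1, Submodule.smul_mem _ _ ha.2.1,
      Submodule.smul_mem _ _ ha.2.2⟩
  | mem x hx =>
    obtain ⟨⟨k, g⟩, rfl⟩ := hx
    dsimp only
    refine ⟨?_, ?_, ?_⟩
    · cases k with
      | ofNat k =>
        have := wmon_mem (e := e) (f := f) (h := h) (.ofNat (k + 1)) g
        rwa [wmon, pow_succ', mul_assoc] at this
      | negSucc k =>
        rw [wmon, pow_succ', ← mul_assoc, ← mul_assoc, A.ef]
        cases k with
        | zero =>
          have := A.aeval_wmon_mem (.ofNat 0) (C (4⁻¹ : ℂ) * (C χ - X ^ 2 + 2 * X)) g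
          simpa only [wmon, pow_zero] using this
        | succ k => exact A.aeval_wmon_mem (.negSucc k) _ g
    · rw [← mul_assoc]
      simpa using A.aeval_wmon_mem k X g
    · cases k with
      | ofNat k =>
        cases k with
        | zero => simpa [wmon] using wmon_mem (e := e) (f := f) (h := h) (.negSucc 0) g
        | succ k =>
          rw [wmon, pow_succ', ← mul_assoc, ← mul_assoc, A.fe]
          exact A.aeval_wmon_mem (.ofNat k) _ g
      | negSucc k =>
        have := wmon_mem (e := e) (f := f) (h := h) (.negSucc (k + 1)) g
        rwa [wmon, pow_succ', mul_assoc] at this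

theorem commute_slSpan {d x : R} (de : Commute d e) (dh : Commute d h) (df : Commute d f)
    (hx : x ∈ slSpan e h f) : Commute d x := by
  induction hx using Submodule.span_induction with
  | zero => exact Commute.zero_right _
  | add a b _ _ ha hb => exact ha.add_right hb
  | smul c a _ ha => exact ha.smul_right c
  | mem x hx =>
    obtain ⟨⟨k, g⟩, rfl⟩ := hx
    refine Commute.mul_right ?_ ?_
    · cases k with
      | ofNat k => exact de.pow_right _
      | negSucc k => exact df.pow_right _
    · induction g using Polynomial.induction_on' with
      | add a b ha hb => simpa using ha.add_right hb
      | monomial n a =>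
        rw [← C_mul_X_pow_eq_monomial, map_mul, aeval_C, map_pow, aeval_X]
        exact (Algebra.commute_algebraMap_right a d).mul_right (dh.pow_right n)

/-- The elements `∑ qⁱ yᵢ` with `yᵢ ∈ Y`. -/
def powSpan (q : R) (Y : Submodule ℂ R) : Submodule ℂ R :=
  Submodule.span ℂ {x | ∃ (i : ℕ), ∃ y ∈ Y, x = q ^ i * y}

theorem exists_sum_of_mem_powSpan {Y : Submodule ℂ R} {x : R} (hx : x ∈ powSpan q Y) :
    ∃ (n : ℕ) (y : ℕ → R), (∀ i, y i ∈ Y) ∧ x = ∑ i ∈ Finset.range n, q ^ i * y i := by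
  have : ∃ y : ℕ →₀ R, (∀ i, y i ∈ Y) ∧ x = y.sum fun i a => q ^ i * a := by
    induction hx using Submodule.span_induction with
    | zero => exact ⟨0, by simp, by simp⟩
    | add a b _ _ ha hb =>
      obtain ⟨y, hy, rfl⟩ := ha
      obtain ⟨y', hy', rfl⟩ := hb
      refine ⟨y + y', fun i => Y.add_mem (hy i) (hy' i), ?_⟩
      rw [Finsupp.sum_add_index'] <;> simp [mul_add]
    | smul c a _ ha =>
      obtain ⟨y, hy, rfl⟩ := ha
      refine ⟨c • y, fun i => Y.smul_mem c (hy i), ?_⟩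
      rw [Finsupp.sum_smul_index' (by simp), Finsupp.smul_sum]
      simp
    | mem x hx =>
      obtain ⟨i, y, hy, rfl⟩ := hx
      refine ⟨Finsupp.single i y, fun j => ?_, by simp⟩
      classical
      rw [Finsupp.single_apply]
      split_ifs
      exacts [hy, Y.zero_mem]
  obtain ⟨y, hy, rfl⟩ := this
  refine ⟨y.support.sup id + 1, y, hy, ?_⟩
  refine Finsupp.sum_of_support_subset _ (fun i hi => ?_) _ (by simp)
  exact Finset.mem_range.2 (Nat.lt_succ_of_le (Finset.le_sup (f := id) hi))

theorem exists_sum_of_mem_slSpan {x : R} (hx : x ∈ slSpan e h f) :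
    ∃ (s : Finset ℤ) (g : ℤ → ℂ[X]), x = ∑ k ∈ s, wmon e f k * aeval h (g k) := by
  have : ∃ g : ℤ →₀ ℂ[X], x = g.sum fun k a => wmon e f k * aeval h a := by
    induction hx using Submodule.span_induction with
    | zero => exact ⟨0, by simp⟩
    | add a b _ _ ha hb =>
      obtain ⟨y, rfl⟩ := ha
      obtain ⟨y', rfl⟩ := hb
      refine ⟨y + y', ?_⟩
      rw [Finsupp.sum_add_index'] <;> simp [mul_add]
    | smul c a _ ha =>
      obtain ⟨y, rfl⟩ := ha
      refine ⟨c • y, ?_⟩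
      rw [Finsupp.sum_smul_index' (by simp), Finsupp.smul_sum]
      simp
    | mem x hx =>
      obtain ⟨⟨k, g⟩, rfl⟩ := hx
      exact ⟨Finsupp.single k g, by simp⟩
  obtain ⟨g, rfl⟩ := this
  exact ⟨g.support, g, rfl⟩

theorem powSpan_induction {Y T : Submodule ℂ R} (H : ∀ (i : ℕ), ∀ y ∈ Y, q ^ i * y ∈ T) :
    powSpan q Y ≤ T := by
  refine Submodule.span_le.2 ?_
  rintro _ ⟨i, y, hy, rfl⟩
  exact H i y hy

theorem mul_mem_powSpan_of_commute {Y : Submodule ℂ R} {d x : R} (hdq : Commute d q)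
    (hd : ∀ y ∈ Y, d * y ∈ Y) (hx : x ∈ powSpan q Y) : d * x ∈ powSpan q Y := by
  refine powSpan_induction (T := (powSpan q Y).comap (LinearMap.mulLeft ℂ d)) (fun i y hy => ?_) hx
  refine Submodule.subset_span ⟨i, d * y, hd y hy, ?_⟩
  simp only [LinearMap.mulLeft_apply]
  rw [← mul_assoc, (hdq.pow_right i).eq, mul_assoc]

theorem self_mul_mem_powSpan {Y : Submodule ℂ R} {x : R} (hx : x ∈ powSpan q Y) :
    q * x ∈ powSpan q Y := by
  refine powSpan_induction (T := (powSpan q Y).comap (LinearMap.mulLeft ℂ q)) (fun i y hy => ?_) hx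
  refine Submodule.subset_span ⟨i + 1, y, hy, ?_⟩
  simp only [LinearMap.mulLeft_apply]
  rw [← mul_assoc, ← pow_succ']

theorem mul_mem_powSpan_of_commutator {Y : Submodule ℂ R} {d x : R} {c : ℂ}
    (hdq : d * q = q * d + algebraMap ℂ R c)
    (hd : ∀ y ∈ Y, d * y ∈ Y) (hx : x ∈ powSpan q Y) : d * x ∈ powSpan q Y := by
  refine powSpan_induction (T := (powSpan q Y).comap (LinearMap.mulLeft ℂ d)) (fun i y hy => ?_) hx
  simp only [Submodule.mem_comap, LinearMap.mulLeft_apply]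
  induction i generalizing y with
  | zero => exact Submodule.subset_span ⟨0, d * y, hd y hy, by simp⟩
  | succ i ih =>
    rw [pow_succ', ← mul_assoc, ← mul_assoc, hdq, add_mul, add_mul, mul_assoc, mul_assoc,
      ← Algebra.smul_def, smul_mul_assoc]
    exact add_mem (self_mul_mem_powSpan (ih y hy))
      (Submodule.smul_mem _ _ (Submodule.subset_span ⟨i, y, hy, rfl⟩))

theorem adjoin_le_powSpan (A : WeylSl2 zz χ e h f p q)
    {u : R} (hu : u ∈ Algebra.adjoin ℂ {e, h, f, p, q}) :
    u ∈ powSpan q (powSpan p (slSpan e h f)) := by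
  set T := powSpan q (powSpan p (slSpan e h f))
  let B : Subalgebra ℂ R :=
    { carrier := {u | ∀ x ∈ T, u * x ∈ T}
      mul_mem' := fun ha hb x hx => by rw [mul_assoc]; exact ha _ (hb _ hx)
      add_mem' := fun ha hb x hx => by rw [add_mul]; exact add_mem (ha _ hx) (hb _ hx)
      algebraMap_mem' := fun c x hx => by
        rw [← Algebra.smul_def]; exact T.smul_mem c hx }
  have h0 : (1 : R) ∈ slSpan e h f := by
    simpa [wmon] using wmon_mem (e := e) (f := f) (h := h) 0 1
  have h1 : (1 : R) ∈ T :=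
    Submodule.subset_span ⟨0, 1, Submodule.subset_span ⟨0, 1, h0, by simp⟩, by simp⟩
  have hB : Algebra.adjoin ℂ {e, h, f, p, q} ≤ B := by
    refine Algebra.adjoin_le ?_
    rintro x (rfl | rfl | rfl | rfl | rfl) y hy
    · exact mul_mem_powSpan_of_commute A.qe.symm (fun z hz =>
        mul_mem_powSpan_of_commute A.pe.symm (fun w hw => (A.mul_mem_slSpan hw).1) hz) hy
    · exact mul_mem_powSpan_of_commute A.qh.symm (fun z hz =>
        mul_mem_powSpan_of_commute A.ph.symm (fun w hw => (A.mul_mem_slSpan hw).2.1) hz) hy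
    · exact mul_mem_powSpan_of_commute A.qf.symm (fun z hz =>
        mul_mem_powSpan_of_commute A.pf.symm (fun w hw => (A.mul_mem_slSpan hw).2.2) hz) hy
    · exact mul_mem_powSpan_of_commutator A.pq (fun z hz => self_mul_mem_powSpan hz) hy
    · exact self_mul_mem_powSpan hy
  simpa using hB hu 1 h1

/-- A two-sided ideal is determined by the elements `eᵏ g(h)`, `fᵏ g(h)` it contains. -/
theorem mem_of_wmon_mem (A : WeylSl2 zz χ e h f p q)
    (hzz : zz ≠ 0) {I J : Submodule ℂ R} (hI : IsTwoSidedSub I)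
    (hJ : ∀ x, ∀ y ∈ J, x * y ∈ J)
    (hIJ : ∀ (k : ℤ) (g : ℂ[X]), wmon e f k * aeval h g ∈ I → wmon e f k * aeval h g ∈ J)
    {u : R} (hu : u ∈ Algebra.adjoin ℂ {e, h, f, p, q}) (huI : u ∈ I) : u ∈ J := by
  obtain ⟨n, y, hy, rfl⟩ := exists_sum_of_mem_powSpan (A.adjoin_le_powSpan hu)
  have hpY : ∀ y ∈ powSpan p (slSpan e h f), Commute p y := by
    intro y hy
    obtain ⟨m, x, hx, rfl⟩ := exists_sum_of_mem_powSpan hy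
    exact Commute.sum_right _ _ _ fun i _ =>
      ((Commute.refl p).pow_right i).mul_right (commute_slSpan A.pe A.ph A.pf (hx i))
  have h1 := mem_of_sum_pow_mul_mem hI hzz A.pq n y (fun i => hpY _ (hy i)) huI
  refine J.sum_mem fun i hi => hJ _ _ ?_
  have h2 := h1 i (Finset.mem_range.1 hi)
  obtain ⟨m, x, hx, hyx⟩ := exists_sum_of_mem_powSpan (hy i)
  rw [hyx] at h2 ⊢
  have hqp : q * p = p * q + algebraMap ℂ R (-zz) := by rw [A.pq, map_neg]; abel
  have h3 := mem_of_sum_pow_mul_mem hI (neg_ne_zero.2 hzz) hqp m x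
    (fun i => commute_slSpan A.qe A.qh A.qf (hx i)) h2
  refine J.sum_mem fun j hj => hJ _ _ ?_
  have h4 := h3 j (Finset.mem_range.1 hj)
  obtain ⟨s, g, hg⟩ := exists_sum_of_mem_slSpan (hx j)
  rw [hg] at h4 ⊢
  have h5 := mem_of_sum_weight_mem hI (h := h) (fun k : ℤ => (2 * k : ℂ))
    (fun a b hab => by simpa using hab) s (fun k => wmon e f k * aeval h (g k)) (fun k => by
      have : aeval h (g k) * h = h * aeval h (g k) := by
        have := congrArg (aeval h) (mul_comm (g k) X)
        simpa using this
      rw [← mul_assoc, A.h_wmon, mul_assoc, mul_assoc, add_mul, this, mul_add, add_sub_cancel_left,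
        ← Algebra.smul_def, mul_smul_comm]) h4
  exact J.sum_mem fun k hk => hIJ _ _ (h5 k hk)

theorem exists_f_pow_mul_e_pow (A : WeylSl2 zz χ e h f p q)
    (k : ℕ) : ∃ g : ℂ[X], g ≠ 0 ∧ f ^ k * e ^ k = aeval h g := by
  induction k with
  | zero => exact ⟨1, one_ne_zero, by simp⟩
  | succ k ih =>
    obtain ⟨g, hg, hk⟩ := ih
    refine ⟨g * (C (4⁻¹ : ℂ) * (C χ - X ^ 2 - 2 * X)).comp (X + C (k * 2 : ℂ)), ?_, ?_⟩
    · refine mul_ne_zero hg (comp_X_add_C_ne_zero_iff.2 fun h0 => ?_)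
      have := congrArg (fun g => coeff g 2) h0
      rw [show (2 : ℂ[X]) = C 2 from rfl] at this
      simp at this
    · rw [pow_succ, pow_succ', mul_assoc, ← mul_assoc f, A.fe,
        aeval_mul_shift (mul_pow_shift A.he k), ← mul_assoc, hk, ← map_mul]

theorem exists_e_pow_mul_f_pow (A : WeylSl2 zz χ e h f p q)
    (k : ℕ) : ∃ g : ℂ[X], g ≠ 0 ∧ e ^ k * f ^ k = aeval h g := by
  induction k with
  | zero => exact ⟨1, one_ne_zero, by simp⟩
  | succ k ih =>
    obtain ⟨g, hg, hk⟩ := ih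
    refine ⟨g * (C (4⁻¹ : ℂ) * (C χ - X ^ 2 + 2 * X)).comp (X + C (k * -2 : ℂ)), ?_, ?_⟩
    · refine mul_ne_zero hg (comp_X_add_C_ne_zero_iff.2 fun h0 => ?_)
      have := congrArg (fun g => coeff g 2) h0
      rw [show (2 : ℂ[X]) = C 2 from rfl] at this
      simp at this
    · rw [pow_succ, pow_succ', mul_assoc, ← mul_assoc e, A.ef,
        aeval_mul_shift (mul_pow_shift A.hf k), ← mul_assoc, hk, ← map_mul]

theorem eq_zero_of_wmon_eq_zero (A : WeylSl2 zz χ e h f p q)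
    (H : ∀ g : ℂ[X], aeval h g = 0 → g = 0) (k : ℤ) (g : ℂ[X])
    (hk : wmon e f k * aeval h g = 0) : g = 0 := by
  cases k with
  | ofNat k =>
    obtain ⟨g', hg', hk'⟩ := A.exists_f_pow_mul_e_pow k
    have : aeval h (g' * g) = 0 := by
      rw [map_mul, ← hk', mul_assoc]; rw [wmon] at hk; rw [hk, mul_zero]
    exact (mul_eq_zero.1 (H _ this)).resolve_left hg'
  | negSucc k =>
    obtain ⟨g', hg', hk'⟩ := A.exists_e_pow_mul_f_pow (k + 1)
    have : aeval h (g' * g) = 0 := by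
      rw [map_mul, ← hk', mul_assoc]; rw [wmon] at hk; rw [hk, mul_zero]
    exact (mul_eq_zero.1 (H _ this)).resolve_left hg'

end WeylSl2

end Ring

section EndModule

variable {M : Type*} [AddCommGroup M] [Module ℂ M]

theorem aeval_apply_of_eigen {T : Module.End ℂ M} {a : ℂ} {x : M} (hx : T x = a • x)
    (g : ℂ[X]) : aeval T g x = g.eval a • x := by
  induction g using Polynomial.induction_on' with
  | add g g' hg hg' => simp [hg, hg', add_smul]
  | monomial n c =>
    have : ∀ n : ℕ, (T ^ n) x = a ^ n • x := by
      intro n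
      induction n with
      | zero => simp
      | succ n ih => rw [pow_succ', Module.End.mul_apply, ih, map_smul, hx, smul_smul, pow_succ]
    simp [aeval_monomial, this, smul_smul, mul_comm]

theorem exists_eigenvector_of_aeval_eq_zero {T : Module.End ℂ M} (g : ℂ[X]) (hg : g ≠ 0)
    {x : M} (hx : x ≠ 0) (hgx : aeval T g x = 0) : ∃ a : ℂ, ∃ y : M, y ≠ 0 ∧ T y = a • y := by
  induction hn : g.natDegree generalizing g with
  | zero =>
    rw [eq_C_of_natDegree_eq_zero hn] at hgx hg
    simp only [aeval_C, Module.algebraMap_end_apply, smul_eq_zero] at hgx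
    exact absurd hgx (not_or.2 ⟨by simpa using hg, hx⟩)
  | succ n ih =>
    obtain ⟨a, ha⟩ := IsAlgClosed.exists_root g (by
      rw [degree_eq_natDegree hg, hn]; exact_mod_cast n.succ_ne_zero)
    obtain ⟨g', rfl⟩ := dvd_iff_isRoot.2 ha
    have hg' : g' ≠ 0 := right_ne_zero_of_mul hg
    by_cases h0 : aeval T g' x = 0
    · refine ih g' hg' h0 ?_
      rw [natDegree_mul (X_sub_C_ne_zero a) hg', natDegree_X_sub_C] at hn
      omega
    · refine ⟨a, _, h0, ?_⟩
      rw [map_mul, Module.End.mul_apply] at hgx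
      simpa [sub_eq_zero] using hgx

/-- An operator of a nonzero complex vector space of countable dimension, all of whose nonzero
translates by scalars are invertible, has an eigenvalue. -/
theorem exists_eq_smul_of_rank_le {T : Module.End ℂ M} [Nontrivial M]
    (hM : Module.rank ℂ M ≤ Cardinal.aleph0)
    (hT : ∀ a : ℂ, T = algebraMap ℂ (Module.End ℂ M) a ∨
      Function.Bijective (T - algebraMap ℂ (Module.End ℂ M) a)) :
    ∃ a : ℂ, T = algebraMap ℂ (Module.End ℂ M) a := by
  classical
  by_contra! hne
  have hbij := fun a => (hT a).resolve_left (hne a)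
  obtain ⟨s, hs⟩ := exists_ne (0 : M)
  choose x hx using fun a => (hbij a).2 s
  have hli : LinearIndependent ℂ x := by
    rw [linearIndependent_iff']
    intro t c hc a ha
    set g : ℂ[X] := ∑ b ∈ t, C (c b) * ∏ b' ∈ t.erase b, (X - C b')
    have hgs : aeval T g s = 0 := by
      have h1 : ∀ b ∈ t, aeval T (C (c b) * ∏ b' ∈ t.erase b, (X - C b')) s
          = aeval T (∏ b' ∈ t, (X - C b')) (c b • x b) := by
        intro b hb
        rw [← Finset.prod_erase_mul t _ hb, map_mul, map_mul, Module.End.mul_apply,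
          Module.End.mul_apply, map_smul (aeval T (X - C b))]
        have : aeval T (X - C b) (x b) = s := by simpa using hx b
        rw [this]
        simp
      rw [map_sum, LinearMap.sum_apply, Finset.sum_congr rfl h1, ← map_sum, hc, map_zero]
    have hg0 : g = 0 := by
      by_contra hg
      obtain ⟨b, y, hy, hTy⟩ := exists_eigenvector_of_aeval_eq_zero g hg hs hgs
      refine hy ((hbij b).1 ?_)
      simp [hTy]
    have h2 := congrArg (eval a) hg0
    simp only [g, eval_finsetSum, eval_mul, eval_C, eval_prod, eval_sub, eval_X, eval_zero] at h2
    rw [Finset.sum_eq_single_of_mem a ha] at h2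
    · refine (mul_eq_zero.1 h2).resolve_right (Finset.prod_ne_zero_iff.2 fun b hb => ?_)
      exact sub_ne_zero.2 (Finset.ne_of_mem_erase hb).symm
    · intro b _ hba
      rw [Finset.prod_eq_zero (Finset.mem_erase.2 ⟨hba.symm, ha⟩) (sub_self a), mul_zero]
  have h3 := hli.cardinal_lift_le_rank
  have h4 : Cardinal.aleph0 < Cardinal.mk ℂ := by
    rw [Cardinal.mk_complex]; exact Cardinal.aleph0_lt_continuum
  rw [← Cardinal.lift_le (a := Module.rank ℂ M)] at hM
  have := h3.trans hM
  rw [Cardinal.lift_aleph0, Cardinal.lift_le_aleph0] at this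
  exact absurd h4 (not_lt.2 this)

namespace WeylSl2

variable {zz χ μ : ℂ} {e h f p q : Module.End ℂ M} {w : M}

theorem h_f_pow_apply (A : WeylSl2 zz χ e h f p q) (hw : h w = μ • w) (i : ℕ) :
    h ((f ^ i) w) = (μ - 2 * i) • (f ^ i) w := by
  have := congrArg (fun T : Module.End ℂ M => T w) (mul_pow_shift A.hf i)
  simp only [Module.End.mul_apply, LinearMap.add_apply, Module.algebraMap_end_apply, hw,
    map_smul, ← add_smul] at this
  rw [this]
  congr 1
  ring

theorem h_e_pow_apply (A : WeylSl2 zz χ e h f p q) (hw : h w = μ • w) (i : ℕ) :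
    h ((e ^ i) w) = (μ + 2 * i) • (e ^ i) w := by
  have := congrArg (fun T : Module.End ℂ M => T w) (mul_pow_shift A.he i)
  simp only [Module.End.mul_apply, LinearMap.add_apply, Module.algebraMap_end_apply, hw,
    map_smul, ← add_smul] at this
  rw [this]
  congr 1
  ring

theorem casimir_eq (A : WeylSl2 zz χ e h f p q)
    (h0 : w ≠ 0) (he : e w = 0) (hw : h w = μ • w) : χ = μ * (μ + 2) := by
  have := congrArg (fun T : Module.End ℂ M => T w) A.fe
  rw [Module.End.mul_apply, he, map_zero, aeval_apply_of_eigen hw, eq_comm, smul_eq_zero] at this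
  have := this.resolve_right h0
  simp at this
  linear_combination this

theorem e_f_pow_apply (A : WeylSl2 zz χ e h f p q)
    (hχ : χ = μ * (μ + 2)) (hw : h w = μ • w) (i : ℕ) :
    e ((f ^ (i + 1)) w) = ((i + 1) * (μ - i)) • (f ^ i) w := by
  rw [pow_succ', Module.End.mul_apply, ← Module.End.mul_apply, A.ef,
    aeval_apply_of_eigen (A.h_f_pow_apply hw i), hχ]
  congr 1
  simp
  ring

theorem f_pow_apply_ne_zero (A : WeylSl2 zz χ e h f p q)
    (h0 : w ≠ 0) (hχ : χ = μ * (μ + 2)) (hw : h w = μ • w) (n : ℕ)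
    (hμ : ∀ i < n, μ ≠ i) : (f ^ n) w ≠ 0 := by
  induction n with
  | zero => simpa
  | succ n ih =>
    intro h1
    have h2 := A.e_f_pow_apply hχ hw n
    rw [h1, map_zero, eq_comm, smul_eq_zero] at h2
    rcases h2 with h2 | h2
    · rcases mul_eq_zero.1 h2 with h3 | h3
      · exact absurd h3 (by exact_mod_cast n.succ_ne_zero)
      · exact hμ n n.lt_succ_self (sub_eq_zero.1 h3)
    · exact ih (fun i hi => hμ i (by omega)) h2

theorem eq_zero_of_aeval_eq_zero (A : WeylSl2 zz χ e h f p q)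
    (h0 : w ≠ 0) (hχ : χ = μ * (μ + 2)) (hw : h w = μ • w)
    (hμ : ∀ i : ℕ, μ ≠ i) (g : ℂ[X]) (hg : aeval h g = 0) : g = 0 := by
  refine eq_zero_of_infinite_isRoot g ?_
  refine (Set.infinite_range_of_injective (f := fun i : ℕ => μ - 2 * i) ?_).mono ?_
  · intro i j hij
    simpa using hij
  · rintro _ ⟨i, rfl⟩
    have := aeval_apply_of_eigen (A.h_f_pow_apply hw i) g
    rw [hg, LinearMap.zero_apply, eq_comm, smul_eq_zero] at this
    exact this.resolve_right (A.f_pow_apply_ne_zero h0 hχ hw i fun i _ => hμ i)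

theorem exists_highest_weight (A : WeylSl2 zz χ e h f p q)
    (g : ℂ[X]) (hg : g ≠ 0) (hgh : aeval h g = 0) (h0 : w ≠ 0) :
    ∃ n : ℕ, χ = n * (n + 2) ∧ ∃ y : M, y ≠ 0 ∧ e y = 0 ∧ h y = (n : ℂ) • y ∧
      (f ^ (n + 1)) y = 0 := by
  have hroot : ∀ (a : ℂ) (y : M), y ≠ 0 → h y = a • y → a ∈ g.roots.toFinset := by
    intro a y hy hay
    have := aeval_apply_of_eigen hay g
    rw [hgh, LinearMap.zero_apply, eq_comm, smul_eq_zero] at this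
    simpa [hg] using this.resolve_right hy
  obtain ⟨a, x, hx, hax⟩ := exists_eigenvector_of_aeval_eq_zero g hg h0
    (by rw [hgh, LinearMap.zero_apply])
  have hnil : ∀ (T : Module.End ℂ M) (c a : ℂ) (x : M), c ≠ 0 →
      (∀ i : ℕ, h ((T ^ i) x) = (a + c * i) • (T ^ i) x) → x ≠ 0 →
      ∃ i : ℕ, (T ^ i) x ≠ 0 ∧ (T ^ (i + 1)) x = 0 := by
    intro T c a x hc hT hx
    have : ∃ i : ℕ, (T ^ i) x = 0 := by
      by_contra! hne
      refine Set.infinite_of_injective_forall_mem (f := fun i : ℕ => a + c * i) ?_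
        (fun i => hroot _ _ (hne i) (hT i)) g.roots.toFinset.finite_toSet
      intro i j hij
      simpa [hc] using hij
    classical
    obtain ⟨i, hi⟩ := Nat.exists_eq_succ_of_ne_zero (n := Nat.find this) (fun h1 => by
      have := Nat.find_spec this
      rw [h1] at this
      exact hx (by simpa using this))
    refine ⟨i, Nat.find_min this (by omega), ?_⟩
    have := Nat.find_spec this
    rwa [hi] at this
  obtain ⟨i, hi, hi'⟩ := hnil e 2 a x two_ne_zero (A.h_e_pow_apply hax) hx
  have hew : e ((e ^ i) x) = 0 := by rwa [pow_succ'] at hi'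
  have hhw := A.h_e_pow_apply hax i
  have hχ := A.casimir_eq hi hew hhw
  obtain ⟨n, hn, hn'⟩ := hnil f (-2) (a + 2 * i) _ (by norm_num)
    (fun j => by rw [A.h_f_pow_apply hhw]; congr 1; ring) hi
  have h2 := A.e_f_pow_apply hχ hhw n
  rw [hn', map_zero, eq_comm, smul_eq_zero] at h2
  have h3 : a + 2 * i = n := by
    have := (mul_eq_zero.1 (h2.resolve_right hn)).resolve_left (by exact_mod_cast n.succ_ne_zero)
    exact sub_eq_zero.1 this
  rw [h3] at hhw hχ
  exact ⟨n, hχ, _, hi, hew, hhw, hn'⟩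

theorem exists_e_pow_f_pow_apply (A : WeylSl2 zz χ e h f p q)
    (hχ : χ = μ * (μ + 2)) (hw : h w = μ • w) (n i k : ℕ)
    (hi : i ≤ n) (hk : k ≤ i) (hμ : μ = n) :
    ∃ c : ℂ, c ≠ 0 ∧ (e ^ k) ((f ^ i) w) = c • (f ^ (i - k)) w := by
  induction k with
  | zero => exact ⟨1, one_ne_zero, by simp⟩
  | succ k ih =>
    obtain ⟨c, hc, hck⟩ := ih (by omega)
    obtain ⟨j, hj⟩ : ∃ j, i - k = j + 1 := ⟨i - k - 1, by omega⟩
    refine ⟨c * ((j + 1) * (μ - j)), mul_ne_zero hc (mul_ne_zero ?_ ?_), ?_⟩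
    · exact_mod_cast j.succ_ne_zero
    · rw [hμ, sub_ne_zero]
      exact_mod_cast (by omega : n ≠ j)
    · rw [pow_succ', Module.End.mul_apply, hck, map_smul, hj, A.e_f_pow_apply hχ hw, smul_smul]
      congr 3
      omega

/-- The elements of `U(sl₂)` and those killing a highest weight vector together with
its `f`-descendants. -/
theorem wmon_eq_zero_iff (A : WeylSl2 zz χ e h f p q) {n : ℕ} (h0 : w ≠ 0) (he : e w = 0)
    (hw : h w = (n : ℂ) • w) (hf : (f ^ (n + 1)) w = 0)
    (hgen : ∀ y : M, ∃ u ∈ Algebra.adjoin ℂ {e, h, f, p, q}, y = u w) (k : ℤ) (g : ℂ[X]) :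
    wmon e f k * aeval h g = 0 ↔ match k with
      | .ofNat k => ∀ i ≤ n, k ≤ i → g.eval ((n : ℂ) - 2 * i) = 0
      | .negSucc k => ∀ i : ℕ, i + (k + 1) ≤ n → g.eval ((n : ℂ) - 2 * i) = 0 := by
  have hχ := A.casimir_eq h0 he hw
  have hf' : ∀ i, n < i → (f ^ i) w = 0 := by
    intro i hi
    obtain ⟨j, rfl⟩ := Nat.exists_eq_add_of_lt hi
    rw [show n + j + 1 = j + (n + 1) by ring, pow_add, Module.End.mul_apply, hf, map_zero]
  have hne : ∀ i ≤ n, (f ^ i) w ≠ 0 := fun i hi =>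
    A.f_pow_apply_ne_zero h0 hχ hw i fun j hj => by exact_mod_cast (by omega : n ≠ j)
  have he' : ∀ k i, i < k → (e ^ k) ((f ^ i) w) = 0 := by
    intro k i hik
    rcases lt_or_ge n i with hi | hi
    · rw [hf' i hi, map_zero]
    · obtain ⟨c, -, hc⟩ := A.exists_e_pow_f_pow_apply hχ hw n i i hi le_rfl rfl
      obtain ⟨j, rfl⟩ := Nat.exists_eq_add_of_lt hik
      rw [show i + j + 1 = j + 1 + i by ring, pow_add, Module.End.mul_apply, hc, pow_add]
      simp [he]
  have hW : ∀ y ∈ slSpan e h f, y w ∈ Submodule.span ℂ (Set.range fun i : ℕ => (f ^ i) w) := by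
    intro y hy
    induction hy using Submodule.span_induction with
    | zero => simp
    | add a b _ _ ha hb => exact add_mem ha hb
    | smul c a _ ha => exact Submodule.smul_mem _ _ ha
    | mem y hy =>
      obtain ⟨⟨k, g⟩, rfl⟩ := hy
      dsimp only
      rw [Module.End.mul_apply, aeval_apply_of_eigen hw, map_smul]
      refine Submodule.smul_mem _ _ ?_
      cases k with
      | ofNat k =>
        cases k with
        | zero => exact Submodule.subset_span ⟨0, by simp [wmon]⟩
        | succ k =>
          have := he' (k + 1) 0 k.succ_pos
          rw [pow_zero, Module.End.one_apply] at this
          rw [wmon, this]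
          exact zero_mem _
      | negSucc k => exact Submodule.subset_span ⟨k + 1, rfl⟩
  have hred : ∀ x ∈ slSpan e h f, (∀ i ≤ n, x ((f ^ i) w) = 0) → x = 0 := by
    intro x hx hxw
    have hpx := commute_slSpan A.pe A.ph A.pf hx
    have hqx := commute_slSpan A.qe A.qh A.qf hx
    have h1 : ∀ y ∈ slSpan e h f, x (y w) = 0 := by
      intro y hy
      have h2 : Submodule.span ℂ (Set.range fun i : ℕ => (f ^ i) w) ≤ LinearMap.ker x := by
        refine Submodule.span_le.2 ?_
        rintro _ ⟨i, rfl⟩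
        rcases lt_or_ge n i with hi | hi
        · simp [hf' i hi]
        · exact hxw i hi
      exact h2 (hW y hy)
    ext y
    obtain ⟨u, hu, rfl⟩ := hgen y
    have h3 : powSpan q (powSpan p (slSpan e h f)) ≤
        LinearMap.ker ((LinearMap.applyₗ w).comp (LinearMap.mulLeft ℂ x)) := by
      refine powSpan_induction fun i y hy => ?_
      have h4 : powSpan p (slSpan e h f) ≤
          LinearMap.ker ((LinearMap.applyₗ w).comp (LinearMap.mulLeft ℂ x)) := by
        refine powSpan_induction fun j z hz => ?_
        rw [LinearMap.mem_ker, LinearMap.comp_apply, LinearMap.mulLeft_apply, ← mul_assoc,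
          ← (hpx.pow_left j).eq, mul_assoc, LinearMap.applyₗ_apply_apply, Module.End.mul_apply,
          Module.End.mul_apply, h1 z hz, map_zero]
      have h5 := h4 hy
      rw [LinearMap.mem_ker, LinearMap.comp_apply, LinearMap.mulLeft_apply,
        LinearMap.applyₗ_apply_apply] at h5 ⊢
      rw [← mul_assoc, ← (hqx.pow_left i).eq, mul_assoc, Module.End.mul_apply, h5, map_zero]
    exact h3 (A.adjoin_le_powSpan hu)
  have hval : ∀ i : ℕ, (wmon e f k * aeval h g) ((f ^ i) w)
      = g.eval ((n : ℂ) - 2 * i) • wmon e f k ((f ^ i) w) := by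
    intro i
    rw [Module.End.mul_apply, aeval_apply_of_eigen (A.h_f_pow_apply hw i), map_smul]
  have hiff : wmon e f k * aeval h g = 0 ↔
      ∀ i ≤ n, g.eval ((n : ℂ) - 2 * i) = 0 ∨ wmon e f k ((f ^ i) w) = 0 := by
    constructor
    · intro hz i _
      have := hval i
      rwa [hz, LinearMap.zero_apply, eq_comm, smul_eq_zero] at this
    · intro H
      refine hred _ (wmon_mem k g) fun i hi => ?_
      rw [hval, smul_eq_zero]
      exact H i hi
  rw [hiff]
  cases k with
  | ofNat k =>
    refine forall₂_congr fun i hi => ?_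
    have : (e ^ k) ((f ^ i) w) = 0 ↔ ¬ k ≤ i := by
      refine ⟨fun hz hk => ?_, fun hk => he' k i (by omega)⟩
      obtain ⟨c, hc, hck⟩ := A.exists_e_pow_f_pow_apply hχ hw n i k hi hk rfl
      rw [hck, smul_eq_zero] at hz
      exact hz.elim hc (hne _ (by omega))
    rw [wmon, this]
    tauto
  | negSucc k =>
    have : ∀ i, (f ^ (k + 1)) ((f ^ i) w) = 0 ↔ ¬ i + (k + 1) ≤ n := by
      intro i
      rw [← Module.End.mul_apply, ← pow_add, add_comm]
      refine ⟨fun hz hk => hne _ hk hz, fun hk => hf' _ (by omega)⟩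
    simp only [wmon, this]
    refine ⟨fun H i hi => (H i (by omega)).resolve_right (not_not.2 hi), fun H i _ => ?_⟩
    by_cases hi : i + (k + 1) ≤ n
    exacts [Or.inl (H i hi), Or.inr hi]

theorem apply_mem_span_of_singular (A : WeylSl2 zz χ e h f p q)
    (he : e w = 0) (hw : h w = μ • w) (hp : p w = 0) {u}
    (hu : u ∈ Algebra.adjoin ℂ {e, h, f, p, q}) :
    u w ∈ Submodule.span ℂ (Set.range fun i : ℕ × ℕ => (q ^ i.1) ((f ^ i.2) w)) := by
  set W := Submodule.span ℂ (Set.range fun i : ℕ × ℕ => (q ^ i.1) ((f ^ i.2) w))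
  have h3 : powSpan q (powSpan p (slSpan e h f)) ≤ W.comap (LinearMap.applyₗ w) := by
    refine powSpan_induction fun i y hy => ?_
    have h4 : powSpan p (slSpan e h f) ≤
        W.comap ((LinearMap.applyₗ w).comp (LinearMap.mulLeft ℂ (q ^ i))) := by
      refine powSpan_induction fun j z hz => ?_
      rw [Submodule.mem_comap, LinearMap.comp_apply, LinearMap.mulLeft_apply,
        LinearMap.applyₗ_apply_apply]
      cases j with
      | succ j =>
        rw [((commute_slSpan A.pe A.ph A.pf hz).pow_left (j + 1)).eq, pow_succ]
        simp [hp]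
      | zero =>
        rw [pow_zero, one_mul]
        induction hz using Submodule.span_induction with
        | zero => simp
        | add a b _ _ ha hb => rw [mul_add]; exact add_mem ha hb
        | smul c a _ ha => rw [mul_smul_comm]; exact Submodule.smul_mem _ _ ha
        | mem y hy =>
          obtain ⟨⟨k, g⟩, rfl⟩ := hy
          dsimp only
          rw [Module.End.mul_apply, Module.End.mul_apply, aeval_apply_of_eigen hw, map_smul,
            map_smul]
          refine Submodule.smul_mem _ _ ?_
          cases k with
          | ofNat k =>
            cases k with
            | zero => exact Submodule.subset_span ⟨(i, 0), by simp [wmon]⟩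
            | succ k => simp [wmon, pow_succ, he]
          | negSucc k => exact Submodule.subset_span ⟨(i, k + 1), rfl⟩
    exact h4 hy
  exact h3 (A.adjoin_le_powSpan hu)

end WeylSl2

end EndModule

section Generators

theorem U_rel {x y : FA} (hxy : Rel x y) {a b : U} (ha : RingQuot.mkAlgHom ℂ Rel x = a)
    (hb : RingQuot.mkAlgHom ℂ Rel y = b) : a = b :=
  ha.symm.trans ((RingQuot.mkAlgHom_rel ℂ hxy).trans hb)

theorem adjoin_range_gen : Algebra.adjoin ℂ (Set.range gen) = ⊤ := by
  have : Set.range gen = RingQuot.mkAlgHom ℂ Rel '' Set.range (FreeAlgebra.ι ℂ : Gen → FA) := by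
    rw [← Set.range_comp]; rfl
  rw [this, ← AlgHom.map_adjoin, FreeAlgebra.adjoin_range_ι, Algebra.map_top,
    AlgHom.range_eq_top]
  exact RingQuot.mkAlgHom_surjective ℂ Rel

theorem U_relations :
    (H * E = E * H + 2 * E ∧ E * F = F * E + H ∧ H * F = F * H - 2 * F ∧ E * Q = Q * E + P ∧
      E * P = P * E) ∧ (H * P = P * H + P ∧ F * P = P * F + Q ∧ F * Q = Q * F ∧
      H * Q = Q * H - Q ∧ P * Q = Q * P + Z) ∧
      (Z * E = E * Z ∧ Z * H = H * Z ∧ Z * F = F * Z ∧ Z * P = P * Z ∧ Z * Q = Q * Z) := by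
  refine ⟨⟨?_, ?_, ?_, ?_, ?_⟩, ⟨?_, ?_, ?_, ?_, ?_⟩, ⟨?_, ?_, ?_, ?_, ?_⟩⟩
  · exact U_rel Rel.he (by simp only [map_mul]; rfl)
      (by simp only [map_mul, map_add, map_ofNat]; rfl)
  · exact U_rel Rel.ef (by simp only [map_mul]; rfl) (by simp only [map_mul, map_add]; rfl)
  · exact U_rel Rel.hf (by simp only [map_mul]; rfl)
      (by simp only [map_mul, map_sub, map_ofNat]; rfl)
  · exact U_rel Rel.eq (by simp only [map_mul]; rfl) (by simp only [map_mul, map_add]; rfl)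
  · exact U_rel Rel.ep (by simp only [map_mul]; rfl) (by simp only [map_mul]; rfl)
  · exact U_rel Rel.hp (by simp only [map_mul]; rfl) (by simp only [map_mul, map_add]; rfl)
  · exact U_rel Rel.fp (by simp only [map_mul]; rfl) (by simp only [map_mul, map_add]; rfl)
  · exact U_rel Rel.fq (by simp only [map_mul]; rfl) (by simp only [map_mul]; rfl)
  · exact U_rel Rel.hq (by simp only [map_mul]; rfl) (by simp only [map_mul, map_sub]; rfl)
  · exact U_rel Rel.pq (by simp only [map_mul]; rfl) (by simp only [map_mul, map_add]; rfl)
  · exact U_rel Rel.ze (by simp only [map_mul]; rfl) (by simp only [map_mul]; rfl)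
  · exact U_rel Rel.zh (by simp only [map_mul]; rfl) (by simp only [map_mul]; rfl)
  · exact U_rel Rel.zf (by simp only [map_mul]; rfl) (by simp only [map_mul]; rfl)
  · exact U_rel Rel.zp (by simp only [map_mul]; rfl) (by simp only [map_mul]; rfl)
  · exact U_rel Rel.zq (by simp only [map_mul]; rfl) (by simp only [map_mul]; rfl)

theorem Z_commute (u : U) : Commute Z u := by
  have hu : u ∈ Algebra.adjoin ℂ (Set.range gen) := adjoin_range_gen ▸ Algebra.mem_top
  obtain ⟨-, -, h1, h2, h3, h4, h5⟩ := U_relations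
  induction hu using Algebra.adjoin_induction with
  | mem x hx =>
    obtain ⟨g, rfl⟩ := hx
    cases g
    exacts [h1, h2, h3, h4, h5, Commute.refl _]
  | algebraMap r => exact Algebra.commute_algebraMap_right r Z
  | add x y _ _ hx hy => exact hx.add_right hy
  | mul x y _ _ hx hy => exact hx.mul_right hy

noncomputable section

/-- The element `e - p²/(2zz)`, which commutes with `p` and `q` modulo `z - zz`. -/
def slE (zz : ℂ) : U := E - (2 * zz)⁻¹ • (P * P)

/-- The element `f + q²/(2zz)`, which commutes with `p` and `q` modulo `z - zz`. -/
def slF (zz : ℂ) : U := F + (2 * zz)⁻¹ • (Q * Q)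

/-- The element `h + qp/zz + 1/2`, which commutes with `p` and `q` modulo `z - zz`. -/
def slH (zz : ℂ) : U := H + zz⁻¹ • (Q * P) + (2⁻¹ : ℂ) • 1

/-- The Casimir element of the triple `slE`, `slH`, `slF`. -/
def slCas (zz : ℂ) : U := (4 : ℂ) • (slF zz * slE zz) + slH zz * slH zz + (2 : ℂ) • slH zz

end

variable {R : Type*} [Ring R] [Algebra ℂ R]

theorem sl_relations {zz : ℂ} (hzz : zz ≠ 0) (ρ : U →ₐ[ℂ] R) (hZ : ρ Z = zz • 1) :
    (Commute (ρ P) (ρ (slE zz)) ∧ Commute (ρ P) (ρ (slH zz)) ∧ Commute (ρ P) (ρ (slF zz))) ∧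
    (Commute (ρ Q) (ρ (slE zz)) ∧ Commute (ρ Q) (ρ (slH zz)) ∧ Commute (ρ Q) (ρ (slF zz))) ∧
    ρ (slH zz) * ρ (slE zz) = ρ (slE zz) * ρ (slH zz) + (2 : ℂ) • ρ (slE zz) ∧
    ρ (slH zz) * ρ (slF zz) = ρ (slF zz) * ρ (slH zz) - (2 : ℂ) • ρ (slF zz) ∧
    ρ (slE zz) * ρ (slF zz) = ρ (slF zz) * ρ (slE zz) + ρ (slH zz) := by
  obtain ⟨⟨h1, h2, h3, h4, h5⟩, ⟨h6, h7, h8, h9, h10⟩, -⟩ := U_relations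
  replace h1 : ρ E * ρ H = ρ H * ρ E - (2 : ℂ) • ρ E := by
    have := congrArg ρ h1
    simp only [map_mul, map_add, map_ofNat] at this
    rw [this, two_smul, two_mul]; abel
  replace h3 : ρ H * ρ F = ρ F * ρ H - (2 : ℂ) • ρ F := by
    have := congrArg ρ h3
    simp only [map_mul, map_sub, map_ofNat] at this
    rw [this, two_smul, two_mul]
  replace h2 := congrArg ρ h2
  replace h4 := congrArg ρ h4
  replace h5 := congrArg ρ h5
  replace h6 := congrArg ρ h6
  replace h7 := congrArg ρ h7
  replace h8 := congrArg ρ h8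
  replace h9 := congrArg ρ h9
  replace h10 := congrArg ρ h10
  simp only [map_mul, map_add, map_sub, hZ] at h2 h4 h5 h6 h7 h8 h9 h10
  simp only [slE, slF, slH, map_add, map_sub, map_smul, map_mul, map_one]
  generalize ρ E = E at *
  generalize ρ F = F at *
  generalize ρ H = H at *
  generalize ρ P = P at *
  generalize ρ Q = Q at *
  have g4 : ∀ x, E * (Q * x) = Q * (E * x) + P * x := fun x => by
    rw [← mul_assoc, h4, add_mul, mul_assoc]
  have g6 : ∀ x, H * (P * x) = P * (H * x) + P * x := fun x => by
    rw [← mul_assoc, h6, add_mul, mul_assoc]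
  have g7 : ∀ x, F * (P * x) = P * (F * x) + Q * x := fun x => by
    rw [← mul_assoc, h7, add_mul, mul_assoc]
  have g8 : ∀ x, F * (Q * x) = Q * (F * x) := fun x => by rw [← mul_assoc, h8, mul_assoc]
  have g9 : ∀ x, H * (Q * x) = Q * (H * x) - Q * x := fun x => by
    rw [← mul_assoc, h9, sub_mul, mul_assoc]
  have g10 : ∀ x, P * (Q * x) = Q * (P * x) + zz • x := fun x => by
    rw [← mul_assoc, h10, add_mul, mul_assoc, smul_mul_assoc, one_mul]
  simp only [Commute, SemiconjBy]
  refine ⟨⟨?_, ?_, ?_⟩, ⟨?_, ?_, ?_⟩, ?_, ?_, ?_⟩ <;>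
  · simp only [mul_add, add_mul, mul_sub, sub_mul, smul_mul_assoc, mul_smul_comm, mul_assoc,
      g4, g6, g7, g8, g9, g10, h1, h2, h3, h4, h5, h6, h7, h8, h9, h10,
      smul_add, smul_sub, mul_one, one_mul] <;>
    (match_scalars <;> field_simp <;> ring)

theorem map_mem_adjoin {zz : ℂ} (ρ : U →ₐ[ℂ] R) (hZ : ρ Z = zz • 1) (u : U) :
    ρ u ∈ Algebra.adjoin ℂ {ρ (slE zz), ρ (slH zz), ρ (slF zz), ρ P, ρ Q} := by
  set B := Algebra.adjoin ℂ {ρ (slE zz), ρ (slH zz), ρ (slF zz), ρ P, ρ Q} with hB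
  have hsub := Algebra.subset_adjoin (R := ℂ) (s := {ρ (slE zz), ρ (slH zz), ρ (slF zz), ρ P, ρ Q})
  rw [← hB] at hsub
  have he : ρ (slE zz) ∈ B := hsub (by simp)
  have hh : ρ (slH zz) ∈ B := hsub (by simp)
  have hf : ρ (slF zz) ∈ B := hsub (by simp)
  have hp : ρ P ∈ B := hsub (by simp)
  have hq : ρ Q ∈ B := hsub (by simp)
  have hle : (⊤ : Subalgebra ℂ U) ≤ B.comap ρ := by
    rw [← adjoin_range_gen]
    refine Algebra.adjoin_le ?_
    rintro _ ⟨g, rfl⟩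
    rw [SetLike.mem_coe, Subalgebra.mem_comap]
    cases g
    · have : gen .E = slE zz + (2 * zz)⁻¹ • (P * P) := by unfold slE E; abel
      rw [this, map_add, map_smul, map_mul]
      exact add_mem he (B.smul_mem (mul_mem hp hp) _)
    · have : gen .H = slH zz - zz⁻¹ • (Q * P) - (2⁻¹ : ℂ) • 1 := by unfold slH H; abel
      rw [this, map_sub, map_sub, map_smul, map_mul, map_smul, map_one]
      exact sub_mem (sub_mem hh (B.smul_mem (mul_mem hq hp) _)) (B.smul_mem (one_mem _) _)
    · have : gen .F = slF zz - (2 * zz)⁻¹ • (Q * Q) := by unfold slF F; abel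
      rw [this, map_sub, map_smul, map_mul]
      exact sub_mem hf (B.smul_mem (mul_mem hq hq) _)
    · exact hp
    · exact hq
    · change ρ Z ∈ B
      rw [hZ]
      exact B.smul_mem (one_mem _) _
  exact hle Algebra.mem_top

theorem slCas_commute {zz : ℂ} (hzz : zz ≠ 0) (ρ : U →ₐ[ℂ] R) (hZ : ρ Z = zz • 1) (u : U) :
    Commute (ρ (slCas zz)) (ρ u) := by
  obtain ⟨⟨p1, p2, p3⟩, ⟨q1, q2, q3⟩, h1, h2, h3⟩ := sl_relations hzz ρ hZ
  have hu := map_mem_adjoin ρ hZ u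
  generalize ρ u = x at hu
  simp only [slCas, map_add, map_smul, map_mul]
  generalize ρ (slE zz) = E at *
  generalize ρ (slF zz) = F at *
  generalize ρ (slH zz) = H at *
  have g1 : ∀ x, H * (E * x) = E * (H * x) + (2 : ℂ) • (E * x) := fun x => by
    rw [← mul_assoc, h1, add_mul, smul_mul_assoc, mul_assoc]
  have g2 : ∀ x, H * (F * x) = F * (H * x) - (2 : ℂ) • (F * x) := fun x => by
    rw [← mul_assoc, h2, sub_mul, smul_mul_assoc, mul_assoc]
  have g3 : ∀ x, E * (F * x) = F * (E * x) + H * x := fun x => by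
    rw [← mul_assoc, h3, add_mul, mul_assoc]
  induction hu using Algebra.adjoin_induction with
  | mem x hx =>
    rcases hx with rfl | rfl | rfl | rfl | rfl
    iterate 3
      · simp only [Commute, SemiconjBy, mul_add, add_mul, mul_sub, smul_mul_assoc,
          mul_smul_comm, mul_assoc, g1, g2, g3, h1, h2, h3, smul_add, smul_sub]
        match_scalars <;> ring
    · exact ((((p3.mul_right p1).smul_right _).add_right (p2.mul_right p2)).add_right
        (p2.smul_right _)).symm
    · exact ((((q3.mul_right q1).smul_right _).add_right (q2.mul_right q2)).add_right
        (q2.smul_right _)).symm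
  | algebraMap r => exact Algebra.commute_algebraMap_right r _
  | add x y _ _ hx hy => exact hx.add_right hy
  | mul x y _ _ hx hy => exact hx.mul_right hy

theorem weylSl2_map {zz χ : ℂ} (hzz : zz ≠ 0) (ρ : U →ₐ[ℂ] R) (hZ : ρ Z = zz • 1)
    (hC : ρ (slCas zz) = χ • 1) :
    WeylSl2 zz χ (ρ (slE zz)) (ρ (slH zz)) (ρ (slF zz)) (ρ P) (ρ Q) := by
  obtain ⟨⟨p1, p2, p3⟩, ⟨q1, q2, q3⟩, h1, h2, h3⟩ := sl_relations hzz ρ hZ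
  have hfe : ρ (slF zz) * ρ (slE zz) =
      aeval (ρ (slH zz)) (C (4⁻¹ : ℂ) * (C χ - X ^ 2 - 2 * X)) := by
    simp only [slCas, map_add, map_smul, map_mul] at hC
    rw [show (2 : ℂ[X]) = C 2 from rfl]
    simp only [map_sub, map_mul, aeval_C, aeval_X, Algebra.algebraMap_eq_smul_one,
      smul_mul_assoc, one_mul, pow_two, ← hC]
    match_scalars <;> norm_num
  refine ⟨?_, p1, p2, p3, q1, q2, q3, ?_, ?_, hfe, ?_⟩
  · rw [Algebra.algebraMap_eq_smul_one, ← hZ, ← map_mul, ← map_mul, ← map_add]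
    exact congrArg ρ U_relations.2.1.2.2.2.2
  · rw [h1, mul_add, ← Algebra.commutes, ← Algebra.smul_def]
  · rw [h2, mul_add, ← Algebra.commutes, ← Algebra.smul_def, neg_smul, sub_eq_add_neg]
  · rw [h3, hfe]
    rw [show (2 : ℂ[X]) = C 2 from rfl]
    simp only [map_sub, map_add, map_mul, aeval_C, aeval_X,
      Algebra.algebraMap_eq_smul_one, smul_mul_assoc, one_mul, pow_two]
    match_scalars <;> norm_num

end Generators

section Model

noncomputable section

/-- The operator sending the basis vector `x` to `c x` times the basis vector `s x`. -/
def shiftOp (s : ℕ × ℕ → ℕ × ℕ) (c : ℕ × ℕ → ℂ) : Module.End ℂ (ℕ × ℕ →₀ ℂ) :=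
  Finsupp.linearCombination ℂ fun x => Finsupp.single (s x) (c x)

theorem shiftOp_single (s : ℕ × ℕ → ℕ × ℕ) (c : ℕ × ℕ → ℂ) (x : ℕ × ℕ) :
    shiftOp s c (Finsupp.single x 1) = c x • Finsupp.single (s x) 1 := by
  simp [shiftOp]

/-- The action of the generators on the model `ℂ[q] ⊗ ℂ[slF]` of a Verma module. -/
def modelGen (zz μ : ℂ) : Gen → Module.End ℂ (ℕ × ℕ →₀ ℂ)
  | .E => shiftOp (fun x => (x.1, x.2 - 1)) (fun x => x.2 * (μ - x.2 + 1)) +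
      shiftOp (fun x => (x.1 - 2, x.2)) (fun x => zz * x.1 * (x.1 - 1) / 2)
  | .H => shiftOp id (fun x => μ - 2 * x.2 - x.1 - 1 / 2)
  | .F => shiftOp (fun x => (x.1, x.2 + 1)) (fun _ => 1) -
      shiftOp (fun x => (x.1 + 2, x.2)) (fun _ => (2 * zz)⁻¹)
  | .P => shiftOp (fun x => (x.1 - 1, x.2)) (fun x => zz * x.1)
  | .Q => shiftOp (fun x => (x.1 + 1, x.2)) (fun _ => 1)
  | .Z => algebraMap ℂ _ zz

set_option maxHeartbeats 1000000 in
theorem lift_modelGen_rel {zz : ℂ} (hzz : zz ≠ 0) (μ : ℂ) {x y : FA} (hxy : Rel x y) :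
    FreeAlgebra.lift ℂ (modelGen zz μ) x = FreeAlgebra.lift ℂ (modelGen zz μ) y := by
  cases hxy
  case ze => simp [ιg, modelGen, Algebra.commutes]
  case zh => simp [ιg, modelGen, Algebra.commutes]
  case zf => simp [ιg, modelGen, Algebra.commutes]
  case zp => simp [ιg, modelGen, Algebra.commutes]
  case zq => simp [ιg, modelGen, Algebra.commutes]
  all_goals
    refine Finsupp.basisSingleOne.ext fun ⟨i, j⟩ => ?_
    rcases i with _ | _ | _ | i <;> rcases j with _ | _ | j
    all_goals
      simp only [ιg, modelGen, map_mul, map_add, map_sub, FreeAlgebra.lift_ι_apply,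
        Module.End.mul_apply, LinearMap.add_apply, LinearMap.sub_apply, shiftOp_single,
        Module.algebraMap_end_apply, two_mul, Finsupp.coe_basisSingleOne, map_smul, id,
        Nat.add_sub_cancel, Nat.reduceAdd, Nat.reduceSub, Nat.zero_sub, add_assoc,
        Nat.reduceSubDiff]
      push_cast
      match_scalars <;> (try field_simp) <;> ring1

/-- The representation of `U` on the model of a Verma module. -/
def modelRep {zz : ℂ} (hzz : zz ≠ 0) (μ : ℂ) : U →ₐ[ℂ] Module.End ℂ (ℕ × ℕ →₀ ℂ) :=
  RingQuot.liftAlgHom ℂ ⟨FreeAlgebra.lift ℂ (modelGen zz μ), 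
    fun _ _ => lift_modelGen_rel hzz μ⟩

theorem modelRep_gen {zz : ℂ} (hzz : zz ≠ 0) (μ : ℂ) (g : Gen) :
    modelRep hzz μ (gen g) = modelGen zz μ g := by
  simp [modelRep, gen, ιg]

theorem modelRep_Q_pow {zz : ℂ} (hzz : zz ≠ 0) (μ : ℂ) (i j k : ℕ) :
    modelRep hzz μ (Q ^ i) (Finsupp.single (k, j) 1) = Finsupp.single (k + i, j) 1 := by
  rw [map_pow, Q, modelRep_gen]
  induction i generalizing k with
  | zero => rfl
  | succ i ih =>
    rw [pow_succ, Module.End.mul_apply, modelGen, shiftOp_single, one_smul, ← modelGen.eq_5, ih]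
    congr 2
    ring

theorem modelRep_slF_pow {zz : ℂ} (hzz : zz ≠ 0) (μ : ℂ) (i j k : ℕ) :
    modelRep hzz μ (slF zz ^ j) (Finsupp.single (i, k) 1) = Finsupp.single (i, k + j) 1 := by
  have h1 : ∀ i k, modelRep hzz μ (slF zz) (Finsupp.single (i, k) 1) =
      Finsupp.single (i, k + 1) 1 := by
    intro i k
    simp only [slF, F, Q, map_add, map_smul, map_mul, modelRep_gen, modelGen, LinearMap.add_apply,
      LinearMap.sub_apply, LinearMap.smul_apply, Module.End.mul_apply, shiftOp_single, one_smul,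
      sub_add_cancel]
  induction j generalizing k with
  | zero => simp
  | succ j ih =>
    rw [pow_succ, map_mul, Module.End.mul_apply, h1, ih]
    congr 2
    ring

/-- The coefficient of the highest weight vector, with respect to the basis `qⁱ slFʲ v` of the
Verma module. -/
theorem exists_coeff_hwVec {zz : ℂ} (hzz : zz ≠ 0) (μ : ℂ) :
    ∃ φ : Verma (μ - 1 / 2) zz →ₗ[ℂ] ℂ, φ (hwVec _ _) = 1 ∧ ∀ i j : ℕ, i + j ≠ 0 →
      φ ((Q ^ i * slF zz ^ j) • hwVec (μ - 1 / 2) zz) = 0 := by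
  let ev : U →ₗ[ℂ] (ℕ × ℕ →₀ ℂ) :=
    (LinearMap.applyₗ (Finsupp.single ((0 : ℕ), (0 : ℕ)) (1 : ℂ))).comp (modelRep hzz μ).toLinearMap
  have hev : ∀ u, ev u = modelRep hzz μ u (Finsupp.single ((0 : ℕ), (0 : ℕ)) (1 : ℂ)) :=
    fun _ => rfl
  have hker : (vermaIdeal (μ - 1 / 2) zz).restrictScalars ℂ ≤ LinearMap.ker ev := by
    intro x hx
    rw [Submodule.restrictScalars_mem, vermaIdeal] at hx
    rw [LinearMap.mem_ker]
    induction hx using Submodule.span_induction with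
    | zero => simp
    | add a b _ _ ha hb => rw [map_add, ha, hb, add_zero]
    | smul u a _ ha => rw [smul_eq_mul, hev, map_mul, Module.End.mul_apply, ← hev, ha, map_zero]
    | mem a ha =>
      rw [hev]
      rcases ha with rfl | rfl | rfl | rfl <;>
      simp [E, P, H, Z, sc, modelRep_gen, modelGen, shiftOp_single]
  refine ⟨(Finsupp.lapply (0, 0)).comp
      (((vermaIdeal (μ - 1 / 2) zz).restrictScalars ℂ).liftQ ev hker),
    ?_, fun i j hij => ?_⟩
  · change ev 1 (0, 0) = 1
    simp [hev]
  · change ev (Q ^ i * slF zz ^ j * 1) (0, 0) = 0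
    rw [hev, mul_one, map_mul, Module.End.mul_apply, modelRep_slF_pow, modelRep_Q_pow]
    refine Finsupp.single_eq_of_ne ?_
    simp
    omega

end

end Model

section HighestWeight

variable {M : Type*} [AddCommGroup M] [Module U M] [Module ℂ M] [IsScalarTower ℂ U M]

theorem lsmul_mem_adjoin {zz : ℂ} (hZ : ∀ m : M, Z • m = zz • m) (u : U) :
    Algebra.lsmul ℂ ℂ M u ∈ Algebra.adjoin ℂ {Algebra.lsmul ℂ ℂ M (slE zz),
      Algebra.lsmul ℂ ℂ M (slH zz), Algebra.lsmul ℂ ℂ M (slF zz), Algebra.lsmul ℂ ℂ M P,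
      Algebra.lsmul ℂ ℂ M Q} :=
  map_mem_adjoin _ (LinearMap.ext hZ) u

theorem mul_shift_neg_one {R : Type*} [Ring R] [Algebra ℂ R] {h q : R} (hq : h * q = q * h - q) :
    h * q = q * (h + algebraMap ℂ R (-1)) := by
  rw [hq, map_neg, map_one, mul_add, mul_neg, mul_one, sub_eq_add_neg]

theorem mul_shift_neg_two {R : Type*} [Ring R] [Algebra ℂ R] {h f q : R}
    (hf : h * f = f * h - 2 * f) (hq : h * q = q * h - q) (c : ℂ) :
    h * (f + c • (q * q)) = (f + c • (q * q)) * (h + algebraMap ℂ R (-2)) := by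
  have h3 : h * (q * q) = q * q * h - 2 * (q * q) := by
    rw [← mul_assoc, hq, sub_mul, mul_assoc, hq, mul_sub, two_mul, mul_assoc]
    abel
  rw [mul_add, mul_smul_comm, h3, hf, map_neg, map_ofNat, ← sub_eq_add_neg, mul_sub, add_mul,
    smul_mul_assoc, smul_sub, mul_two, two_mul, two_mul, smul_add]
  abel

theorem H_mul_Q_pow_mul_slF_pow (zz : ℂ) (i j : ℕ) :
    H * (Q ^ i * slF zz ^ j) =
      Q ^ i * slF zz ^ j * (H + algebraMap ℂ U (-(i + 2 * j))) := by
  obtain ⟨⟨-, -, hf, -, -⟩, ⟨-, -, -, hq, -⟩, -⟩ := U_relations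
  rw [← mul_assoc, mul_pow_shift (mul_shift_neg_one hq), mul_assoc, add_mul,
    mul_pow_shift (e := slF zz) (mul_shift_neg_two hf hq _),
    Algebra.commutes _ (slF zz ^ j), ← mul_add, add_assoc, ← map_add, mul_assoc]
  congr 4
  ring

/-- `v` generates `M` and is a highest weight vector of central charge `zz` and `slH`-weight `μ`. -/
structure IsHighestWeight (zz μ : ℂ) (v : M) : Prop where
  generates : ∀ m : M, ∃ u : U, m = u • v
  P_smul : P • v = 0
  slE_smul : slE zz • v = 0
  slH_smul : slH zz • v = μ • v
  Z_smul : Z • v = zz • v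

namespace IsHighestWeight

variable {zz μ : ℂ} {v : M}

theorem Z_smul_eq (hv : IsHighestWeight zz μ v) (m : M) : Z • m = zz • m := by
  obtain ⟨u, rfl⟩ := hv.generates m
  rw [smul_smul, (Z_commute u).eq, mul_smul, hv.Z_smul, smul_comm]

theorem slCas_smul (hv : IsHighestWeight zz μ v)
    (hzz : zz ≠ 0) (m : M) : slCas zz • m = (μ * (μ + 2)) • m := by
  obtain ⟨u, rfl⟩ := hv.generates m
  have h1 : slCas zz • v = (μ * (μ + 2)) • v := by
    simp only [slCas, add_smul, smul_assoc, mul_smul, hv.slE_smul, hv.slH_smul, smul_zero,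
      smul_comm (slH zz) μ v]
    module
  have h2 := LinearMap.congr_fun
    (slCas_commute hzz (Algebra.lsmul ℂ ℂ M) (LinearMap.ext hv.Z_smul_eq) u).eq v
  simp only [Module.End.mul_apply, Algebra.lsmul_coe] at h2
  rw [h2, h1, smul_comm]

theorem weylSl2 (hv : IsHighestWeight zz μ v) (hzz : zz ≠ 0) :
    WeylSl2 zz (μ * (μ + 2)) (Algebra.lsmul ℂ ℂ M (slE zz)) (Algebra.lsmul ℂ ℂ M (slH zz))
      (Algebra.lsmul ℂ ℂ M (slF zz)) (Algebra.lsmul ℂ ℂ M P) (Algebra.lsmul ℂ ℂ M Q) :=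
  weylSl2_map hzz _ (LinearMap.ext hv.Z_smul_eq) (LinearMap.ext (hv.slCas_smul hzz))

theorem map (hv : IsHighestWeight zz μ v)
    {N : Type*} [AddCommGroup N] [Module U N] [Module ℂ N] [IsScalarTower ℂ U N]
    (f : M →ₗ[U] N) (hf : Function.Surjective f) : IsHighestWeight zz μ (f v) where
  generates n := by
    obtain ⟨m, rfl⟩ := hf n
    obtain ⟨u, rfl⟩ := hv.generates m
    exact ⟨u, map_smul f u v⟩
  P_smul := by rw [← map_smul, hv.P_smul, map_zero]
  slE_smul := by rw [← map_smul, hv.slE_smul, map_zero]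
  slH_smul := by rw [← map_smul, hv.slH_smul, LinearMap.map_smul_of_tower]
  Z_smul := by rw [← map_smul, hv.Z_smul, LinearMap.map_smul_of_tower]

theorem H_smul (hv : IsHighestWeight zz μ v) : H • v = (μ - 1 / 2) • v := by
  have h1 : H = slH zz - zz⁻¹ • (Q * P) - (2⁻¹ : ℂ) • 1 := by unfold slH H; abel
  rw [h1, sub_smul, sub_smul, smul_assoc, smul_assoc, mul_smul, hv.P_smul, hv.slH_smul, one_smul,
    smul_zero, smul_zero]
  module

theorem mem_span (hv : IsHighestWeight zz μ v) (hzz : zz ≠ 0) (y : M) :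
    y ∈ Submodule.span ℂ (Set.range fun i : ℕ × ℕ => (Q ^ i.1 * slF zz ^ i.2) • v) := by
  obtain ⟨u, rfl⟩ := hv.generates y
  have := (hv.weylSl2 hzz).apply_mem_span_of_singular (w := v) hv.slE_smul
    hv.slH_smul hv.P_smul (lsmul_mem_adjoin hv.Z_smul_eq u)
  simpa only [← map_pow, Algebra.lsmul_coe, smul_smul] using this

theorem exists_aeval_H_smul_eq (hv : IsHighestWeight zz μ v)
    (hzz : zz ≠ 0) {φ : M →ₗ[ℂ] ℂ} (h1 : φ v = 1)
    (h0 : ∀ i j : ℕ, i + j ≠ 0 → φ ((Q ^ i * slF zz ^ j) • v) = 0) (y : M) :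
    ∃ g : ℂ[X], g.eval (μ - 1 / 2) = 1 ∧ aeval H g • y = φ y • v := by
  have ha : ∀ (g : ℂ[X]) {a : ℂ} {x : M}, H • x = a • x → aeval H g • x = g.eval a • x := by
    intro g a x hx
    rw [← aeval_apply_of_eigen (T := Algebra.lsmul ℂ ℂ M H) hx, aeval_algHom_apply,
      Algebra.lsmul_coe]
  induction hv.mem_span hzz y using Submodule.span_induction with
  | zero => exact ⟨1, by simp, by simp⟩
  | smul c a _ ha =>
    obtain ⟨g, hg, hga⟩ := ha
    exact ⟨g, hg, by rw [smul_comm, hga, map_smul, smul_smul, smul_eq_mul]⟩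
  | add a b _ _ hga hgb =>
    obtain ⟨g, hg, hga⟩ := hga
    obtain ⟨g', hg', hgb⟩ := hgb
    refine ⟨g * g', by rw [eval_mul, hg, hg', mul_one], ?_⟩
    rw [smul_add, map_mul, mul_smul _ _ b, hgb, ← map_mul, mul_comm, map_mul, mul_smul, hga,
      smul_comm, smul_comm _ (φ b), ha g hv.H_smul, ha g' hv.H_smul, hg, hg', one_smul, map_add,
      add_smul]
  | mem y hy =>
    obtain ⟨⟨i, j⟩, rfl⟩ := hy
    dsimp only
    by_cases hij : i + j = 0
    · obtain ⟨rfl, rfl⟩ : i = 0 ∧ j = 0 := by omega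
      exact ⟨1, by simp, by simp [h1]⟩
    · have hne : (i + 2 * j : ℂ) ≠ 0 := by exact_mod_cast (by omega : i + 2 * j ≠ 0)
      refine ⟨C (i + 2 * j : ℂ)⁻¹ * (X - C (μ - 1 / 2 - (i + 2 * j))), ?_, ?_⟩
      · rw [eval_mul, eval_C, eval_sub, eval_X, eval_C, sub_sub_cancel, inv_mul_cancel₀ hne]
      have : H • (Q ^ i * slF zz ^ j) • v =
          (μ - 1 / 2 - (i + 2 * j)) • (Q ^ i * slF zz ^ j) • v := by
        rw [smul_smul, H_mul_Q_pow_mul_slF_pow, mul_smul, add_smul, algebraMap_smul, hv.H_smul,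
          ← add_smul, smul_comm, ← sub_eq_add_neg]
      rw [ha _ this, h0 i j hij, eval_mul, eval_sub, eval_X, eval_C, eval_C, sub_self, mul_zero]
      rw [zero_smul, zero_smul]

theorem apply_eq_zero_of_mem (hv : IsHighestWeight zz μ v)
    (hzz : zz ≠ 0) {φ : M →ₗ[ℂ] ℂ} (h1 : φ v = 1)
    (h0 : ∀ i j : ℕ, i + j ≠ 0 → φ ((Q ^ i * slF zz ^ j) • v) = 0)
    {N : Submodule U M} (hN : N ≠ ⊤) {y : M} (hy : y ∈ N) : φ y = 0 := by
  by_contra hne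
  obtain ⟨g, -, hg⟩ := hv.exists_aeval_H_smul_eq hzz h1 h0 y
  have hvN : v ∈ N := by
    have := N.smul_mem (algebraMap ℂ U (φ y)⁻¹) (N.smul_mem (aeval H g) hy)
    rwa [hg, algebraMap_smul, smul_smul, inv_mul_cancel₀ hne, one_smul] at this
  refine hN (eq_top_iff.2 fun m _ => ?_)
  obtain ⟨u, rfl⟩ := hv.generates m
  exact N.smul_mem u hvN

theorem notMem_sSup_ne_top (hv : IsHighestWeight zz μ v)
    (hzz : zz ≠ 0) {φ : M →ₗ[ℂ] ℂ} (h1 : φ v = 1)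
    (h0 : ∀ i j : ℕ, i + j ≠ 0 → φ ((Q ^ i * slF zz ^ j) • v) = 0) :
    v ∉ sSup {N : Submodule U M | N ≠ ⊤} := by
  let K : Submodule U M :=
    { carrier := {y | ∀ u : U, φ (u • y) = 0}
      zero_mem' := by simp
      add_mem' := fun ha hb u => by rw [smul_add, map_add, ha u, hb u, add_zero]
      smul_mem' := fun u y hy u' => by rw [smul_smul]; exact hy _ }
  have hle : sSup {N : Submodule U M | N ≠ ⊤} ≤ K :=
    sSup_le fun N hN y hy u => hv.apply_eq_zero_of_mem hzz h1 h0 hN (N.smul_mem u hy)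
  intro hmem
  have := hle hmem 1
  rw [one_smul, h1] at this
  exact one_ne_zero this

theorem slF_pow_smul_mem_sSup_ne_top {n : ℕ} (hv : IsHighestWeight zz n v) (hzz : zz ≠ 0)
    {φ : M →ₗ[ℂ] ℂ} (h1 : φ v = 1)
    (h0 : ∀ i j : ℕ, i + j ≠ 0 → φ ((Q ^ i * slF zz ^ j) • v) = 0) :
    slF zz ^ (n + 1) • v ∈ sSup {N : Submodule U M | N ≠ ⊤} := by
  have A := hv.weylSl2 hzz
  set w := slF zz ^ (n + 1) • v with hw
  have hne : Submodule.span U {w} ≠ ⊤ := by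
    intro htop
    have hmem : v ∈ Submodule.span U {w} := htop ▸ Submodule.mem_top
    obtain ⟨u, hu⟩ := Submodule.mem_span_singleton.1 hmem
    have hpow : w = (Algebra.lsmul ℂ ℂ M (slF zz) ^ (n + 1)) v := by
      rw [← map_pow, Algebra.lsmul_coe]
    have h2 := A.e_f_pow_apply rfl hv.slH_smul n
    rw [← hpow, sub_self, mul_zero, zero_smul] at h2
    have h3 := A.h_f_pow_apply hv.slH_smul (n + 1)
    rw [← hpow] at h3
    have h4 : Algebra.lsmul ℂ ℂ M P w = 0 := by
      rw [hpow, ← Module.End.mul_apply, (A.pf.pow_right _).eq, Module.End.mul_apply]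
      exact (congrArg _ hv.P_smul).trans (map_zero _)
    have h5 := A.apply_mem_span_of_singular h2 h3 h4 (lsmul_mem_adjoin hv.Z_smul_eq u)
    have h6 : Submodule.span ℂ (Set.range fun i : ℕ × ℕ =>
        (Algebra.lsmul ℂ ℂ M Q ^ i.1) ((Algebra.lsmul ℂ ℂ M (slF zz) ^ i.2) w)) ≤
        LinearMap.ker φ := by
      rw [Submodule.span_le]
      rintro _ ⟨⟨i, j⟩, rfl⟩
      rw [SetLike.mem_coe, LinearMap.mem_ker]
      simp only [← map_pow, Algebra.lsmul_coe, hw, smul_smul, ← pow_add]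
      exact h0 i _ (by omega)
    have h7 : φ (u • w) = 0 := h6 h5
    rw [hu, h1] at h7
    exact one_ne_zero h7
  exact le_sSup (a := Submodule.span U {w}) hne (Submodule.mem_span_singleton_self w)

theorem of_smul_eq_zero (hgen : ∀ m : M, ∃ u : U, m = u • v) (hE : E • v = 0) (hP : P • v = 0)
    (hH : (H - sc (μ - 1 / 2)) • v = 0) (hZ : (Z - sc zz) • v = 0) : IsHighestWeight zz μ v := by
  rw [sub_smul, sub_eq_zero, sc, algebraMap_smul] at hH hZ
  refine ⟨hgen, hP, ?_, ?_, hZ⟩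
  · rw [slE, sub_smul, smul_assoc, mul_smul, hP, hE, smul_zero, smul_zero, sub_zero]
  · rw [slH, add_smul, add_smul, smul_assoc, smul_assoc, mul_smul, hP, hH, one_smul, smul_zero,
      smul_zero]
    module

end IsHighestWeight

end HighestWeight

section Verma

theorem isHighestWeight_hwVec (zz μ : ℂ) :
    IsHighestWeight zz μ (hwVec (μ - 1 / 2) zz) := by
  have h0 : ∀ x ∈ ({E, P, H - sc (μ - 1 / 2), Z - sc zz} : Set U),
      x • hwVec (μ - 1 / 2) zz = 0 := by
    intro x hx
    rw [hwVec, ← Submodule.Quotient.mk_smul, Submodule.Quotient.mk_eq_zero, smul_eq_mul, mul_one]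
    exact Submodule.subset_span hx
  have hgen : ∀ m : Verma (μ - 1 / 2) zz, ∃ u : U, m = u • hwVec (μ - 1 / 2) zz := by
    intro m
    obtain ⟨u, rfl⟩ := Submodule.Quotient.mk_surjective _ m
    exact ⟨u, by rw [hwVec, ← Submodule.Quotient.mk_smul, smul_eq_mul, mul_one]⟩
  exact IsHighestWeight.of_smul_eq_zero hgen (h0 E (by simp)) (h0 P (by simp))
    (h0 (H - sc _) (by simp)) (h0 (Z - sc _) (by simp))

/-- The image of the highest weight vector of the Verma module in its simple quotient. -/
theorem exists_isHighestWeight_simpleHW {zz : ℂ} (hzz : zz ≠ 0) (μ : ℂ) :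
    ∃ v : SimpleHW (μ - 1 / 2) zz, v ≠ 0 ∧ IsHighestWeight zz μ v ∧
      ∀ n : ℕ, μ = n → slF zz ^ (n + 1) • v = 0 := by
  obtain ⟨φ, h1, h0⟩ := exists_coeff_hwVec hzz μ
  have hv := isHighestWeight_hwVec zz μ
  refine ⟨(vermaRad (μ - 1 / 2) zz).mkQ (hwVec _ _), ?_,
    hv.map _ (Submodule.mkQ_surjective _), ?_⟩
  · rw [Submodule.mkQ_apply, ne_eq, Submodule.Quotient.mk_eq_zero]
    exact hv.notMem_sSup_ne_top hzz h1 h0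
  · rintro n rfl
    rw [← map_smul, Submodule.mkQ_apply, Submodule.Quotient.mk_eq_zero]
    exact hv.slF_pow_smul_mem_sSup_ne_top hzz h1 h0

end Verma

section Annihilator

theorem map_wmon {R R' : Type*} [Ring R] [Algebra ℂ R] [Ring R'] [Algebra ℂ R'] (φ : R →ₐ[ℂ] R')
    (e f h : R) (k : ℤ) (g : ℂ[X]) :
    φ (wmon e f k * aeval h g) = wmon (φ e) (φ f) k * aeval (φ h) g := by
  rw [map_mul, aeval_algHom_apply]
  cases k <;> simp [wmon]

section Comparison

variable {M N : Type*} [AddCommGroup M] [Module U M] [Module ℂ M] [IsScalarTower ℂ U M]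
  [AddCommGroup N] [Module U N] [Module ℂ N] [IsScalarTower ℂ U N]

/-- Annihilators of modules with fixed central charge and fixed action of `slCas` are compared
through the monomials `slEᵏ g(slH)` and `slFᵏ g(slH)` they contain. -/
theorem smul_eq_zero_of_wmon {zz χ : ℂ} (hzz : zz ≠ 0) (hM : ∀ m : M, Z • m = zz • m)
    (hN : ∀ n : N, Z • n = zz • n) (hCM : ∀ m : M, slCas zz • m = χ • m)
    (hCN : ∀ n : N, slCas zz • n = χ • n)
    (hMN : ∀ (k : ℤ) (g : ℂ[X]),
      wmon (Algebra.lsmul ℂ ℂ M (slE zz)) (Algebra.lsmul ℂ ℂ M (slF zz)) k *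
        aeval (Algebra.lsmul ℂ ℂ M (slH zz)) g = 0 →
      wmon (Algebra.lsmul ℂ ℂ N (slE zz)) (Algebra.lsmul ℂ ℂ N (slF zz)) k *
        aeval (Algebra.lsmul ℂ ℂ N (slH zz)) g = 0)
    {u : U} (hu : ∀ m : M, u • m = 0) (n : N) : u • n = 0 := by
  let ρ : U →ₐ[ℂ] Module.End ℂ M × Module.End ℂ N :=
    (Algebra.lsmul ℂ ℂ M).prod (Algebra.lsmul ℂ ℂ N)
  have hZ : ρ Z = zz • 1 := Prod.ext (LinearMap.ext hM) (LinearMap.ext hN)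
  have hC : ρ (slCas zz) = χ • 1 := Prod.ext (LinearMap.ext hCM) (LinearMap.ext hCN)
  let I : Submodule ℂ (Module.End ℂ M × Module.End ℂ N) := LinearMap.ker (LinearMap.fst ℂ _ _)
  let J : Submodule ℂ (Module.End ℂ M × Module.End ℂ N) := LinearMap.ker (LinearMap.snd ℂ _ _)
  have hI : IsTwoSidedSub I := by
    intro x y hy
    rw [LinearMap.mem_ker, LinearMap.fst_apply] at hy
    rw [LinearMap.mem_ker, LinearMap.fst_apply, LinearMap.mem_ker, LinearMap.fst_apply,
      Prod.fst_mul, Prod.fst_mul, hy, mul_zero, zero_mul]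
    exact ⟨rfl, rfl⟩
  have hJ : ∀ x, ∀ y ∈ J, x * y ∈ J := by
    intro x y hy
    rw [LinearMap.mem_ker, LinearMap.snd_apply] at hy
    rw [LinearMap.mem_ker, LinearMap.snd_apply, Prod.snd_mul, hy, mul_zero]
  have hmem : ρ u ∈ J := by
    refine (weylSl2_map hzz ρ hZ hC).mem_of_wmon_mem hzz hI hJ (fun k g hk => ?_)
      (map_mem_adjoin ρ hZ u) (LinearMap.ext hu)
    have h1 := (map_wmon (AlgHom.fst ℂ (Module.End ℂ M) (Module.End ℂ N)) _ _ _ k g).symm.trans hk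
    exact (map_wmon (AlgHom.snd ℂ (Module.End ℂ M) (Module.End ℂ N)) _ _ _ k g).trans (hMN k g h1)
  exact LinearMap.congr_fun (show Algebra.lsmul ℂ ℂ N u = 0 from hmem) n

end Comparison

theorem rank_U_le : Module.rank ℂ U ≤ Cardinal.aleph0 := by
  have h1 : Module.rank ℂ FA ≤ Cardinal.aleph0 := by
    rw [FreeAlgebra.rank_eq]
    have : Countable Gen := Function.Injective.countable (f := fun g : Gen => g.ctorIdx) (by
      intro a b; cases a <;> cases b <;> simp [Gen.ctorIdx])
    simp
  exact (LinearMap.rank_le_of_surjective (RingQuot.mkAlgHom ℂ Rel).toLinearMap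
    (RingQuot.mkAlgHom_surjective ℂ Rel)).trans h1

theorem exists_slCas_smul_eq {M : Type} [AddCommGroup M] [Module U M] [Module ℂ M]
    [IsScalarTower ℂ U M] [IsSimpleModule U M] {zz : ℂ} (hzz : zz ≠ 0)
    (hZ : ∀ m : M, Z • m = zz • m) : ∃ χ : ℂ, ∀ m : M, slCas zz • m = χ • m := by
  have := IsSimpleModule.nontrivial U M
  obtain ⟨v, hv⟩ := exists_ne (0 : M)
  have hrank : Module.rank ℂ M ≤ Cardinal.aleph0 :=
    (LinearMap.rank_le_of_surjective ((LinearMap.toSpanSingleton U M v).restrictScalars ℂ)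
      (IsSimpleModule.toSpanSingleton_surjective U hv)).trans rank_U_le
  obtain ⟨χ, hχ⟩ := exists_eq_smul_of_rank_le (T := Algebra.lsmul ℂ ℂ M (slCas zz)) hrank
    fun a => by
      let T : M →ₗ[U] M :=
        { toFun m := slCas zz • m - a • m
          map_add' x y := by rw [smul_add, smul_add]; abel
          map_smul' u m := by
            have h2 := LinearMap.congr_fun
              (slCas_commute hzz (Algebra.lsmul ℂ ℂ M) (LinearMap.ext hZ) u).eq m
            simp only [Module.End.mul_apply, Algebra.lsmul_coe] at h2
            rw [h2, smul_comm a u, RingHom.id_apply, smul_sub] }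
      rcases LinearMap.bijective_or_eq_zero T with h | h
      · exact Or.inr h
      · refine Or.inl (LinearMap.ext fun m => ?_)
        exact sub_eq_zero.1 (LinearMap.congr_fun h m)
  exact ⟨χ, fun m => LinearMap.congr_fun hχ m⟩

theorem exists_weight (χ : ℂ) : ∃ μ : ℂ, χ = μ * (μ + 2) ∧ ∀ n : ℕ, μ ≠ n := by
  obtain ⟨s, hs⟩ := IsAlgClosed.exists_pow_nat_eq (χ + 1) (n := 2) (by norm_num)
  by_cases h : ∃ n : ℕ, s - 1 = n
  · obtain ⟨n, hn⟩ := h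
    refine ⟨-s - 1, by linear_combination -hs, fun m hm => ?_⟩
    have : ((n + m + 2 : ℕ) : ℂ) = 0 := by
      push_cast
      linear_combination -hn - hm
    exact absurd (Nat.cast_eq_zero.1 this) (by omega)
  · push Not at h
    exact ⟨s - 1, by linear_combination -hs, h⟩

theorem exists_same_annihilator {M : Type} [AddCommGroup M] [Module U M] [Module ℂ M]
    [IsScalarTower ℂ U M] [IsSimpleModule U M] {zz : ℂ} (hzz : zz ≠ 0)
    (hZ : ∀ m : M, Z • m = zz • m) :
    ∃ μ : ℂ, ∀ u : U, (∀ m : M, u • m = 0) ↔ ∀ w : SimpleHW (μ - 1 / 2) zz, u • w = 0 := by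
  obtain ⟨χ, hχ⟩ := exists_slCas_smul_eq hzz hZ
  have A := weylSl2_map hzz (Algebra.lsmul ℂ ℂ M) (LinearMap.ext hZ) (LinearMap.ext hχ)
  by_cases hfaithful : ∀ g : ℂ[X], aeval (Algebra.lsmul ℂ ℂ M (slH zz)) g = 0 → g = 0
  · obtain ⟨μ, rfl, hμ⟩ := exists_weight χ
    obtain ⟨v, hv0, hv, -⟩ := exists_isHighestWeight_simpleHW hzz μ
    have B := hv.weylSl2 hzz
    refine ⟨μ, fun u => ⟨?_, ?_⟩⟩
    · refine smul_eq_zero_of_wmon hzz hZ hv.Z_smul_eq hχ (hv.slCas_smul hzz) fun k g hk => ?_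
      rw [A.eq_zero_of_wmon_eq_zero hfaithful k g hk, map_zero, mul_zero]
    · refine smul_eq_zero_of_wmon hzz hv.Z_smul_eq hZ (hv.slCas_smul hzz) hχ fun k g hk => ?_
      rw [B.eq_zero_of_wmon_eq_zero (B.eq_zero_of_aeval_eq_zero hv0 rfl hv.slH_smul hμ) k g hk,
        map_zero, mul_zero]
  · push Not at hfaithful
    obtain ⟨g, hg, hg0⟩ := hfaithful
    have := IsSimpleModule.nontrivial U M
    obtain ⟨m, hm⟩ := exists_ne (0 : M)
    obtain ⟨n, rfl, y, hy0, hey, hhy, hfy⟩ := A.exists_highest_weight g hg0 hg hm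
    obtain ⟨v, hv0, hv, hfv⟩ := exists_isHighestWeight_simpleHW hzz (n : ℂ)
    have hM := A.wmon_eq_zero_iff hy0 hey hhy hfy fun x => by
      obtain ⟨u, hu⟩ := IsSimpleModule.toSpanSingleton_surjective U hy0 x
      exact ⟨_, lsmul_mem_adjoin hZ u, hu.symm⟩
    have hL := (hv.weylSl2 hzz).wmon_eq_zero_iff (n := n) hv0 hv.slE_smul hv.slH_smul
      (by rw [← map_pow]; exact hfv n rfl) fun x => by
        obtain ⟨u, hu⟩ := hv.generates x
        exact ⟨_, lsmul_mem_adjoin hv.Z_smul_eq u, hu⟩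
    refine ⟨n, fun u => ⟨?_, ?_⟩⟩
    · exact smul_eq_zero_of_wmon hzz hZ hv.Z_smul_eq hχ (hv.slCas_smul hzz) fun k g hk =>
        (hL k g).2 ((hM k g).1 hk)
    · exact smul_eq_zero_of_wmon hzz hv.Z_smul_eq hZ (hv.slCas_smul hzz) hχ fun k g hk =>
        (hM k g).2 ((hL k g).1 hk)

end Annihilator

end Auxiliary

/-- Corollary 764 of the paper: every primitive ideal of `U`
with nonzero central charge is the annihilator of a simple highest weight module
with the same (nonzero) central charge: if `S` is a simple `U`-module on which
`z` acts by the nonzero scalar `zz`, then `Ann_U(S) = Ann_U(L(λ))` for some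
`λ ∈ 𝔥*` with `λ(z) = zz`. -/
theorem primitive_ideal_of_nonzero_charge (zz : ℂ) (hzz : zz ≠ 0)
    (S : ModuleCat.{0} U) (hS : IsSimpleModule U S)
    (hcharge : ∀ v : S, Z • v = sc zz • v) :
    ∃ hh : ℂ, ∀ u : U, (∀ v : S, u • v = 0) ↔ ∀ w : SimpleHW hh zz, u • w = 0 := by
  let : Module ℂ S := Module.compHom S (algebraMap ℂ U)
  have : IsScalarTower ℂ U S := ⟨fun a u s => by rw [Algebra.smul_def, mul_smul]; rfl⟩
  obtain ⟨μ, hμ⟩ := exists_same_annihilator (M := S) hzz hcharge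
  exact ⟨μ - 1 / 2, hμ⟩

end Schrodinger
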